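/- For the Euclidean control system with Hamiltonians H_u(q,p) = |p|²/2 + V_0(q) + Σ_{j=1}^d u_j q_j + u_{d+1} e^{−|q|²/2}, every Hamiltonian diffeomorphism of T*ℝ^d is small-time approximately reachable: for every Ψ ∈ DHam(T*ℝ^d), every ε > 0, every compact K ⊂ ℝ^{2d} and every ℓ ∈ ℕ there exist τ ∈ [0,ε] and a piecewise constant control u(·) on [0,τ] with ‖Φ^τ_{H_u} − Ψ‖_{C^ℓ(K)} < ε. -/

import Mathlib

open MeasureTheory Real

noncomputable section

/-- The phase space `T*ℝ^d = ℝ^d × ℝ^d` (positions `q` and momenta `p`),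
identified with `ℝ^{2d}` with the sup norm and the Lebesgue (symplectic volume) measure. -/
abbrev Phase (d : ℕ) := (Fin d → ℝ) × (Fin d → ℝ)

/-- The Hamiltonian vector field of a function `H : Phase d → ℝ`:
`H⃗(q,p) = (∂_p H(q,p), −∂_q H(q,p))`. -/
def hamVF {d : ℕ} (H : Phase d → ℝ) (x : Phase d) : Phase d :=
  (fun i => fderiv ℝ H x (0, Pi.single i 1),
   fun i => -(fderiv ℝ H x (Pi.single i 1, 0)))

/-- `φ` is the global flow of the (complete) vector field `X`. -/
def IsFlowOf {d : ℕ} (X : Phase d → Phase d) (φ : ℝ → Phase d → Phase d) : Prop :=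
  (∀ x, φ 0 x = x) ∧ ∀ x t, HasDerivAt (fun s => φ s x) (X (φ t x)) t

/-- `Φ` is a smooth diffeomorphism of phase space. -/
def IsDiffeo {d : ℕ} (Φ : Phase d → Phase d) : Prop :=
  ContDiff ℝ (⊤ : ℕ∞) Φ ∧
    ∃ Ψ, ContDiff ℝ (⊤ : ℕ∞) Ψ ∧ Function.LeftInverse Ψ Φ ∧ Function.RightInverse Ψ Φ

/-- `Φ` is a Hamiltonian diffeomorphism of `T*ℝ^d`: a smooth diffeomorphism which is the
time-1 flow map of a smooth time-dependent Hamiltonian whose non-autonomous Hamiltonian flow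
is defined on `[0,1]` from every initial point. -/
def IsHamDiffeo {d : ℕ} (Φ : Phase d → Phase d) : Prop :=
  IsDiffeo Φ ∧
  ∃ (H : ℝ → Phase d → ℝ) (φ : ℝ → Phase d → Phase d),
    ContDiff ℝ (⊤ : ℕ∞) (fun z : ℝ × Phase d => H z.1 z.2) ∧
    (∀ x, φ 0 x = x) ∧
    (∀ x, ∀ t ∈ Set.Icc (0:ℝ) 1,
      HasDerivWithinAt (fun s => φ s x) (hamVF (H t) (φ t x)) (Set.Icc (0:ℝ) 1) t) ∧
    Φ = φ 1

/-- `Φ` is the flow map from time `0` to time `τ` of the time-dependent Hamiltonian vector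
field `H⃗_{u(t)}` for some piecewise constant control `u(·) : [0,τ] → U` (finitely many
pieces): i.e. `Φ` is a finite composition of flows of the autonomous fields `H⃗_{u_i}`
for nonnegative durations summing to `τ`. -/
def Reachable {d : ℕ} {U : Type*} (Ham : U → Phase d → ℝ) (τ : ℝ)
    (Φ : Phase d → Phase d) : Prop :=
  ∃ (n : ℕ) (dur : Fin n → ℝ) (u : Fin n → U) (φ : Fin n → ℝ → Phase d → Phase d),
    (∀ i, 0 ≤ dur i) ∧ (∑ i, dur i) = τ ∧
    (∀ i, IsFlowOf (hamVF (Ham (u i))) (φ i)) ∧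
    Φ = (List.ofFn (fun i => φ i (dur i))).foldl (fun g f => f ∘ g) id

/-- `‖Φ − Ψ‖_{C^ℓ(K)} < ε`: all iterated derivatives of the difference up to order `ℓ`
are smaller than `ε` on `K`. -/
def CloseCl {d : ℕ} (ℓ : ℕ) (K : Set (Phase d)) (ε : ℝ) (Φ Ψ : Phase d → Phase d) : Prop :=
  ∀ j ≤ ℓ, ∀ x ∈ K, ‖iteratedFDeriv ℝ j (fun y => Φ y - Ψ y) x‖ < ε

/-- `Ψ ∈ R̄_st`: the diffeomorphism `Ψ` is small-time approximately reachable for the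
control system with controlled Hamiltonians `Ham u`, `u ∈ U`. -/
def SmallTimeReachable {d : ℕ} {U : Type*} (Ham : U → Phase d → ℝ)
    (Ψ : Phase d → Phase d) : Prop :=
  ∀ ε > 0, ∀ K : Set (Phase d), IsCompact K → ∀ ℓ : ℕ,
    ∃ τ ∈ Set.Icc (0:ℝ) ε, ∃ Φ, Reachable Ham τ Φ ∧ CloseCl ℓ K ε Φ Ψ

/-- A function `f` with complete Hamiltonian vector field is STAR (small-time approximately
reachable) if its flow at every time `s ∈ ℝ` belongs to `R̄_st`. -/
def IsSTAR {d : ℕ} {U : Type*} (Ham : U → Phase d → ℝ) (f : Phase d → ℝ) : Prop :=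
  (∃ φ, IsFlowOf (hamVF f) φ) ∧
  ∀ φ, IsFlowOf (hamVF f) φ → ∀ s : ℝ, SmallTimeReachable Ham (φ s)

/-- The Poisson bracket `{f,g} = Σ_j (∂_{p_j} f ∂_{q_j} g − ∂_{q_j} f ∂_{p_j} g)`. -/
def poissonBracket {d : ℕ} (f g : Phase d → ℝ) : Phase d → ℝ :=
  fun x => ∑ j, (fderiv ℝ f x (0, Pi.single j 1) * fderiv ℝ g x (Pi.single j 1, 0)
      - fderiv ℝ f x (Pi.single j 1, 0) * fderiv ℝ g x (0, Pi.single j 1))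

/-- The mechanical Hamiltonian `H_u(q,p) = |p|²/2 + V_0(q) + Σ_j u_j V_j(q)`. -/
def mechHam {d m : ℕ} (V0 : (Fin d → ℝ) → ℝ) (V : Fin m → (Fin d → ℝ) → ℝ)
    (u : Fin m → ℝ) : Phase d → ℝ :=
  fun x => (∑ i, (x.2 i) ^ 2) / 2 + V0 x.1 + ∑ j, u j * V j x.1

/-- The Euclidean controlled Hamiltonian
`H_u(q,p) = |p|²/2 + V_0(q) + Σ_{j=1}^d u_j q_j + u_{d+1} e^{−|q|²/2}`,
with control `u ∈ ℝ^d × ℝ ≃ ℝ^{d+1}`. -/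
def eucHam {d : ℕ} (V0 : (Fin d → ℝ) → ℝ) (u : (Fin d → ℝ) × ℝ) : Phase d → ℝ :=
  fun x => (∑ i, (x.2 i) ^ 2) / 2 + V0 x.1 + (∑ j, u.1 j * x.1 j)
    + u.2 * Real.exp (-(∑ i, (x.1 i) ^ 2) / 2)

/-- The frequencies `k_1 = e_1, …, k_{d−1} = e_{d−1}, k_d = (1,…,1)`. -/
def kvec (d : ℕ) (j : Fin d) : Fin d → ℝ :=
  if (j : ℕ) < d - 1 then Pi.single j 1 else fun _ => 1

/-- The torus controlled Hamiltonian (lifted to `ℝ^d × ℝ^d`)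
`H_u(q,p) = |p|²/2 + V_0(q) + Σ_{j=1}^d (u_{2j−1} cos(k_j·q) + u_{2j} sin(k_j·q))`,
with control `u ∈ (ℝ²)^d ≃ ℝ^{2d}`. -/
def torusHam {d : ℕ} (V0 : (Fin d → ℝ) → ℝ) (u : Fin d → ℝ × ℝ) : Phase d → ℝ :=
  fun x => (∑ i, (x.2 i) ^ 2) / 2 + V0 x.1 +
    ∑ j, ((u j).1 * Real.cos (∑ i, kvec d j i * x.1 i) +
          (u j).2 * Real.sin (∑ i, kvec d j i * x.1 i))

/-- The vertical shear `(q,p) ↦ (q, p − ∇f(q))`. -/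
def vshear {d : ℕ} (f : (Fin d → ℝ) → ℝ) : Phase d → Phase d :=
  fun x => (x.1, fun i => x.2 i - fderiv ℝ f x.1 (Pi.single i 1))

/-- The horizontal shear `(q,p) ↦ (q + ∇g(p), p)`. -/
def hshear {d : ℕ} (g : (Fin d → ℝ) → ℝ) : Phase d → Phase d :=
  fun x => (fun i => x.1 i + fderiv ℝ g x.2 (Pi.single i 1), x.2)

/-- `M` is a mesh of size `h`: the closed sup-norm cubes `C̄(m_n,h)` cover `ℝ^{2d}` and the
open cubes `C(m_n,h)` are pairwise disjoint. -/
def IsMesh {d : ℕ} (h : ℝ) (M : ℕ → Phase d) : Prop :=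
  (∀ x : Phase d, ∃ n, ‖x - M n‖ ≤ h) ∧
  ∀ n ℓ : ℕ, n ≠ ℓ →
    Disjoint {x : Phase d | ‖x - M n‖ < h} {x : Phase d | ‖x - M ℓ‖ < h}

/-- `F` is a permutation of the mesh `M` of size `h`: a bijection translating every open
cube of the mesh onto another one. -/
def IsMeshPermutation {d : ℕ} (h : ℝ) (M : ℕ → Phase d) (F : Phase d → Phase d) : Prop :=
  Function.Bijective F ∧
  ∀ n : ℕ, ∃ ℓ : ℕ, ∀ x : Phase d, ‖x - M n‖ < h → F x = x + (M ℓ - M n)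

/-- The fundamental domain `Q = [0,2π)^d × ℝ^d` of `T*𝕋^d` in `ℝ^d × ℝ^d`. -/
def torusBlock (d : ℕ) : Set (Phase d) :=
  {x : Phase d | ∀ i, 0 ≤ x.1 i ∧ x.1 i < 2 * Real.pi}

/-- A torus density of class `L^r`: a measurable function on `ℝ^d × ℝ^d`, `2π`-periodic in
each position variable, with finite `L^r` norm on the fundamental domain `Q`. -/
def IsTorusDensity {d : ℕ} (p : ENNReal) (ρ : Phase d → ℝ) : Prop :=
  Measurable ρ ∧
  (∀ (q : Fin d → ℝ) (pp : Fin d → ℝ) (k : Fin d → ℤ),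
    ρ (fun i => q i + 2 * Real.pi * (k i), pp) = ρ (q, pp)) ∧
  eLpNorm ρ p (volume.restrict (torusBlock d)) < ⊤

end
section Part1
open MeasureTheory Real

open Filter Topology

noncomputable section

namespace HamReach

section SMdefs

variable (E F : Type) [NormedAddCommGroup E] [NormedSpace ℝ E]
  [NormedAddCommGroup F] [NormedSpace ℝ F]

/-- The space of smooth maps, as a submodule. -/
def smoothSub : Submodule ℝ (E → F) where
  carrier := {f | ContDiff ℝ (⊤ : ℕ∞) f}
  add_mem' := by
    intro a b ha hb
    simp only [Set.mem_ofPred_eq] at *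
    exact ContDiff.add ha hb
  zero_mem' := by
    simp only [Set.mem_ofPred_eq]
    exact contDiff_const
  smul_mem' := by
    intro c a ha
    simp only [Set.mem_ofPred_eq] at *
    exact ContDiff.const_smul c ha

/-- The space of smooth maps, as a type synonym carrying its own topology. -/
def SM : Type := smoothSub E F

instance : AddCommGroup (SM E F) := inferInstanceAs (AddCommGroup (smoothSub E F))
instance : Module ℝ (SM E F) := inferInstanceAs (Module ℝ (smoothSub E F))

variable {E F} in
/-- The underlying function of a smooth map. -/
def SM.fn (f : SM E F) : E → F := Subtype.val (p := fun g => g ∈ smoothSub E F) f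

instance : CoeFun (SM E F) (fun _ => E → F) := ⟨fun f => f.fn⟩

end SMdefs

variable {E F G P : Type} [NormedAddCommGroup E] [NormedSpace ℝ E]
  [NormedAddCommGroup F] [NormedSpace ℝ F] [NormedAddCommGroup G] [NormedSpace ℝ G]
  [NormedAddCommGroup P] [NormedSpace ℝ P]

namespace SM

/-- Bundle a smooth map. -/
def mk (f : E → F) (hf : ContDiff ℝ (⊤ : ℕ∞) f) : SM E F := ⟨f, hf⟩

@[simp] lemma mk_apply (f : E → F) (hf : ContDiff ℝ (⊤ : ℕ∞) f) (x : E) : mk f hf x = f x := rfl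

lemma smooth (f : SM E F) : ContDiff ℝ (⊤ : ℕ∞) f := f.2

lemma differentiable (f : SM E F) : Differentiable ℝ f :=
  f.smooth.differentiable (by simp)

lemma continuous (f : SM E F) : Continuous f := f.smooth.continuous

lemma ext {f g : SM E F} (h : ∀ x, f x = g x) : f = g := Subtype.ext (funext h)

@[simp] lemma add_apply (f g : SM E F) (x : E) : (f + g) x = f x + g x := rfl
@[simp] lemma sub_apply (f g : SM E F) (x : E) : (f - g) x = f x - g x := rfl
@[simp] lemma neg_apply (f : SM E F) (x : E) : (-f) x = - f x := rfl
@[simp] lemma smul_apply (c : ℝ) (f : SM E F) (x : E) : (c • f) x = c • f x := rfl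
@[simp] lemma zero_apply (x : E) : (0 : SM E F) x = 0 := rfl

/-- Composition. -/
def comp (f : SM F G) (g : SM E F) : SM E G := mk (fun x => f (g x)) (f.smooth.comp g.smooth)

@[simp] lemma comp_apply (f : SM F G) (g : SM E F) (x : E) : f.comp g x = f (g x) := rfl

/-- The identity. -/
def id : SM E E := mk (fun x => x) contDiff_id

@[simp] lemma id_apply (x : E) : (id : SM E E) x = x := rfl

/-- A continuous linear map as smooth map. -/
def ofCLM (L : E →L[ℝ] F) : SM E F := mk L L.contDiff

@[simp] lemma ofCLM_apply (L : E →L[ℝ] F) (x : E) : ofCLM L x = L x := rfl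

/-- Constant maps. -/
def const (c : F) : SM E F := mk (fun _ => c) contDiff_const

@[simp] lemma const_apply (c : F) (x : E) : (const c : SM E F) x = c := rfl

/-- Pairing. -/
def pair (f : SM E F) (g : SM E G) : SM E (F × G) :=
  mk (fun x => (f x, g x)) (f.smooth.prodMk g.smooth)

@[simp] lemma pair_apply (f : SM E F) (g : SM E G) (x : E) : pair f g x = (f x, g x) := rfl

lemma T_aux (f : SM E F) :
    ContDiff ℝ (⊤ : ℕ∞) (fun z : E × E => (f z.1, fderiv ℝ f z.1 z.2)) := by
  have h := f.smooth
  have h1 : ContDiff ℝ (⊤ : ℕ∞) (fderiv ℝ f) := h.fderiv_right (by simp)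
  exact (h.comp contDiff_fst).prodMk ((h1.comp contDiff_fst).clm_apply contDiff_snd)

/-- The tangent map. -/
def T : SM E F →ₗ[ℝ] SM (E × E) (F × F) where
  toFun f := mk (fun z : E × E => (f z.1, fderiv ℝ f z.1 z.2)) f.T_aux
  map_add' f g := by
    refine ext fun z => ?_
    have : fderiv ℝ (f + g : SM E F) z.1 = fderiv ℝ f z.1 + fderiv ℝ g z.1 :=
      fderiv_add (f.differentiable _) (g.differentiable _)
    simp [this]
  map_smul' c f := by
    refine ext fun z => ?_
    have : fderiv ℝ (c • f : SM E F) z.1 = c • fderiv ℝ f z.1 :=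
      fderiv_const_smul (f.differentiable _) c
    simp [this]

@[simp] lemma T_apply (f : SM E F) (z : E × E) : T f z = (f z.1, fderiv ℝ f z.1 z.2) := rfl

lemma T_comp (f : SM F G) (g : SM E F) : T (f.comp g) = (T f).comp (T g) := by
  refine ext fun z => ?_
  have : fderiv ℝ (f.comp g) z.1 = (fderiv ℝ f (g z.1)).comp (fderiv ℝ g z.1) :=
    fderiv_comp z.1 (f.differentiable _) (g.differentiable _)
  simp [this]

lemma T_id : T (id : SM E E) = id := by
  refine ext fun z => ?_
  have : fderiv ℝ (id : SM E E) z.1 = ContinuousLinearMap.id ℝ E := fderiv_id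
  simp [this]

/-- The shuffle used for pairings. -/
def shuffle : ((F × F) × (G × G)) →L[ℝ] ((F × G) × (F × G)) :=
  (((ContinuousLinearMap.fst ℝ F F).prodMap (ContinuousLinearMap.fst ℝ G G)).prod
    ((ContinuousLinearMap.snd ℝ F F).prodMap (ContinuousLinearMap.snd ℝ G G)))

lemma T_pair (f : SM E F) (g : SM E G) :
    T (pair f g) = (ofCLM (shuffle (F := F) (G := G))).comp (pair (T f) (T g)) := by
  refine ext fun z => ?_
  have : fderiv ℝ (pair f g) z.1 = (fderiv ℝ f z.1).prod (fderiv ℝ g z.1) :=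
    (f.differentiable _).fderiv_prodMk (g.differentiable _)
  rw [T_apply, this]
  rfl

/-- Forget to continuous maps. -/
def toCM : SM E F →ₗ[ℝ] C(E, F) where
  toFun f := ⟨f, f.continuous⟩
  map_add' _ _ := rfl
  map_smul' _ _ := rfl

@[simp] lemma toCM_apply (f : SM E F) (x : E) : toCM f x = f x := rfl

end SM

/-- The `C^k` compact-open topology. -/
@[reducible] def topK : ℕ → (E F : Type) → [NormedAddCommGroup E] → [NormedSpace ℝ E] →
    [NormedAddCommGroup F] → [NormedSpace ℝ F] → TopologicalSpace (SM E F)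
  | 0, E, F, _, _, _, _ => TopologicalSpace.induced (SM.toCM : SM E F → C(E, F)) inferInstance
  | k + 1, E, F, _, _, _, _ =>
      TopologicalSpace.induced (SM.T : SM E F → SM (E × E) (F × F)) (topK k (E × E) (F × F))

instance : TopologicalSpace (SM E F) := ⨅ k, topK k E F

/-- Convergence in the `C^k` topology. -/
def TK {ι : Type*} (k : ℕ) (l : Filter ι) (f : ι → SM E F) (f₀ : SM E F) : Prop :=
  Tendsto f l (@nhds _ (topK k E F) f₀)

lemma tendsto_iff_TK {ι : Type*} {l : Filter ι} {f : ι → SM E F} {f₀ : SM E F} :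
    Tendsto f l (𝓝 f₀) ↔ ∀ k, TK k l f f₀ := by
  show Tendsto f l (@nhds _ (⨅ k, topK k E F) f₀) ↔ _
  rw [nhds_iInf, tendsto_iInf]; rfl

lemma TK_zero {ι : Type*} {l : Filter ι} {f : ι → SM E F} {f₀ : SM E F} :
    TK 0 l f f₀ ↔ Tendsto (fun i => SM.toCM (f i)) l (𝓝 (SM.toCM f₀)) := by
  show Tendsto f l (@nhds _ (TopologicalSpace.induced _ _) f₀) ↔ _
  rw [nhds_induced, tendsto_comap_iff]; rfl

lemma TK_succ {ι : Type*} {k : ℕ} {l : Filter ι} {f : ι → SM E F} {f₀ : SM E F} :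
    TK (k+1) l f f₀ ↔ TK k l (fun i => SM.T (f i)) (SM.T f₀) := by
  show Tendsto f l (@nhds _ (TopologicalSpace.induced _ (topK k (E × E) (F × F))) f₀) ↔ _
  rw [@nhds_induced _ _ (topK k (E × E) (F × F)), tendsto_comap_iff]; rfl

lemma TK_const {ι : Type*} {k : ℕ} {l : Filter ι} (f₀ : SM E F) : TK k l (fun _ => f₀) f₀ :=
  @tendsto_const_nhds _ (topK k E F) _ _ _

lemma TK_comp [FiniteDimensional ℝ F] {ι : Type*} {l : Filter ι} (k : ℕ) {f : ι → SM F G}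
    {f₀ : SM F G} {g : ι → SM E F} {g₀ : SM E F} (hf : TK k l f f₀) (hg : TK k l g g₀) :
    TK k l (fun i => (f i).comp (g i)) (f₀.comp g₀) := by
  induction k generalizing E F G with
  | zero =>
    rw [TK_zero] at *
    exact (ContinuousMap.continuous_comp'.tendsto (SM.toCM g₀, SM.toCM f₀)).comp
      (hg.prodMk_nhds hf)
  | succ k ih =>
    rw [TK_succ] at *
    simp only [SM.T_comp]
    exact ih hf hg

lemma TK_add {ι : Type*} {l : Filter ι} (k : ℕ) {f g : ι → SM E F}
    {f₀ g₀ : SM E F} (hf : TK k l f f₀) (hg : TK k l g g₀) :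
    TK k l (fun i => f i + g i) (f₀ + g₀) := by
  induction k generalizing E F with
  | zero =>
    rw [TK_zero] at *
    simp only [map_add]
    exact hf.add hg
  | succ k ih =>
    rw [TK_succ] at *
    simp only [map_add]
    exact ih hf hg

lemma TK_smul {ι : Type*} {l : Filter ι} (k : ℕ) {f : ι → SM E F}
    {f₀ : SM E F} {c : ι → ℝ} {c₀ : ℝ} (hc : Tendsto c l (𝓝 c₀)) (hf : TK k l f f₀) :
    TK k l (fun i => c i • f i) (c₀ • f₀) := by
  induction k generalizing E F with
  | zero =>
    rw [TK_zero] at *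
    simp only [map_smul]
    exact hc.smul hf
  | succ k ih =>
    rw [TK_succ] at *
    simp only [map_smul]
    exact ih hf

lemma TK_pair [FiniteDimensional ℝ F] [FiniteDimensional ℝ G] {ι : Type*} {l : Filter ι} (k : ℕ)
    {f : ι → SM E F} {f₀ : SM E F} {g : ι → SM E G} {g₀ : SM E G}
    (hf : TK k l f f₀) (hg : TK k l g g₀) :
    TK k l (fun i => SM.pair (f i) (g i)) (SM.pair f₀ g₀) := by
  induction k generalizing E F G with
  | zero =>
    rw [TK_zero] at *
    rw [ContinuousMap.tendsto_iff_forall_isCompact_tendstoUniformlyOn] at *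
    intro K hK
    have h1 := hf K hK
    have h2 := hg K hK
    intro u hu
    exact (tendsto_id.prodMk tendsto_id).eventually (h1.prodMk h2 u hu)
  | succ k ih =>
    rw [TK_succ] at *
    simp only [SM.T_pair]
    exact TK_comp k (TK_const _) (ih hf hg)

/-! ### consequences for the full topology -/

section tendsto
variable {ι : Type*} {l : Filter ι}

lemma tendsto_comp [FiniteDimensional ℝ F] {f : ι → SM F G} {f₀ : SM F G} {g : ι → SM E F}
    {g₀ : SM E F} (hf : Tendsto f l (𝓝 f₀)) (hg : Tendsto g l (𝓝 g₀)) :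
    Tendsto (fun i => (f i).comp (g i)) l (𝓝 (f₀.comp g₀)) := by
  rw [tendsto_iff_TK] at *
  exact fun k => TK_comp k (hf k) (hg k)

lemma tendsto_pair [FiniteDimensional ℝ F] [FiniteDimensional ℝ G] {f : ι → SM E F}
    {f₀ : SM E F} {g : ι → SM E G}
    {g₀ : SM E G} (hf : Tendsto f l (𝓝 f₀)) (hg : Tendsto g l (𝓝 g₀)) :
    Tendsto (fun i => (f i).pair (g i)) l (𝓝 (f₀.pair g₀)) := by
  rw [tendsto_iff_TK] at *
  exact fun k => TK_pair k (hf k) (hg k)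

lemma tendsto_add {f g : ι → SM E F} {f₀ g₀ : SM E F}
    (hf : Tendsto f l (𝓝 f₀)) (hg : Tendsto g l (𝓝 g₀)) :
    Tendsto (fun i => f i + g i) l (𝓝 (f₀ + g₀)) := by
  rw [tendsto_iff_TK] at *
  exact fun k => TK_add k (hf k) (hg k)

lemma tendsto_smul {f : ι → SM E F} {f₀ : SM E F} {c : ι → ℝ} {c₀ : ℝ}
    (hc : Tendsto c l (𝓝 c₀)) (hf : Tendsto f l (𝓝 f₀)) :
    Tendsto (fun i => c i • f i) l (𝓝 (c₀ • f₀)) := by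
  rw [tendsto_iff_TK] at *
  exact fun k => TK_smul k hc (hf k)

lemma tendsto_sub {f g : ι → SM E F} {f₀ g₀ : SM E F}
    (hf : Tendsto f l (𝓝 f₀)) (hg : Tendsto g l (𝓝 g₀)) :
    Tendsto (fun i => f i - g i) l (𝓝 (f₀ - g₀)) := by
  have := tendsto_add hf (tendsto_smul (tendsto_const_nhds (x := (-1:ℝ))) hg)
  simpa [sub_eq_add_neg] using this

lemma tendsto_T {f : ι → SM E F} {f₀ : SM E F} (hf : Tendsto f l (𝓝 f₀)) :
    Tendsto (fun i => SM.T (f i)) l (𝓝 (SM.T f₀)) := by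
  rw [tendsto_iff_TK] at *
  exact fun k => TK_succ.1 (hf (k+1))

lemma tendsto_toCM {f : ι → SM E F} {f₀ : SM E F} (hf : Tendsto f l (𝓝 f₀)) :
    Tendsto (fun i => SM.toCM (f i)) l (𝓝 (SM.toCM f₀)) :=
  TK_zero.1 (tendsto_iff_TK.1 hf 0)

end tendsto

lemma continuous_comp [FiniteDimensional ℝ F] :
    Continuous (fun p : SM F G × SM E F => p.1.comp p.2) := by
  rw [continuous_iff_continuousAt]
  intro p
  exact tendsto_comp continuous_fst.continuousAt continuous_snd.continuousAt

/-- Insertion of a parameter. -/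
def SM.ins (p : P) : SM E (P × E) := SM.pair (SM.const p) SM.id

@[simp] lemma SM.ins_apply (p : P) (x : E) : (SM.ins p : SM E (P × E)) x = (p, x) := rfl

lemma SM.T_const (p : P) : SM.T (SM.const p : SM E P) = SM.const (p, 0) := by
  refine SM.ext fun z => ?_
  have : fderiv ℝ (SM.const p : SM E P) z.1 = 0 := fderiv_const_apply p
  simp [this]

lemma TK_constp (k : ℕ) {ι : Type*} {l : Filter ι} {p : ι → P} {p₀ : P}
    (hp : Tendsto p l (𝓝 p₀)) :
    TK k l (fun i => (SM.const (p i) : SM E P)) (SM.const p₀) := by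
  induction k generalizing E P with
  | zero =>
    rw [TK_zero]
    exact (ContinuousMap.continuous_const'.tendsto p₀).comp hp
  | succ k ih =>
    rw [TK_succ]
    simp only [SM.T_const]
    exact ih (hp.prodMk_nhds tendsto_const_nhds)

lemma tendsto_ins [FiniteDimensional ℝ E] [FiniteDimensional ℝ P] {ι : Type*} {l : Filter ι}
    {p : ι → P} {p₀ : P} (hp : Tendsto p l (𝓝 p₀)) :
    Tendsto (fun i => (SM.ins (p i) : SM E (P × E))) l (𝓝 (SM.ins p₀)) :=
  tendsto_pair (tendsto_iff_TK.2 fun k => TK_constp k hp) tendsto_const_nhds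

/-- Jointly smooth families are continuous families of smooth maps. -/
lemma tendsto_param [FiniteDimensional ℝ E] [FiniteDimensional ℝ P] {ι : Type*} {l : Filter ι}
    {p : ι → P} {p₀ : P} (hp : Tendsto p l (𝓝 p₀)) (f : SM (P × E) F) :
    Tendsto (fun i => f.comp (SM.ins (p i))) l (𝓝 (f.comp (SM.ins p₀))) :=
  tendsto_comp tendsto_const_nhds (tendsto_ins hp)

end HamReach

end

end Part1

section Part2
open MeasureTheory Real

open Filter Topology

noncomputable section

namespace HamReach

section ODE

variable {E : Type} [NormedAddCommGroup E] [NormedSpace ℝ E] [CompleteSpace E]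

/-- Local solutions with uniform existence time. -/
lemma ode_local (f : ℝ → E → E) (K : NNReal) (hK : ∀ t, LipschitzWith K (f t))
    (hc : ∀ x, Continuous (fun t => f t x)) (t0 : ℝ) (x0 : E) :
    ∃ v : ℝ → E, v t0 = x0 ∧ ∀ t ∈ Set.Icc (t0 - 1/(2*(K+1))) (t0 + 1/(2*(K+1))),
      HasDerivWithinAt v (f t (v t)) (Set.Icc (t0 - 1/(2*(K+1))) (t0 + 1/(2*(K+1)))) t := by
  set δ : ℝ := 1/(2*(K+1)) with hδ
  have hK0 : (0:ℝ) ≤ K := K.2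
  have hδ0 : 0 < δ := by positivity
  obtain ⟨M, hM⟩ := (isCompact_Icc (a := t0 - δ) (b := t0 + δ)).exists_bound_of_continuousOn
    (hc x0).continuousOn
  set M' : NNReal := ⟨max M 0, le_max_right _ _⟩ with hM'
  set a : NNReal := ⟨2 * M' * δ, by positivity⟩ with ha
  have hmem : t0 ∈ Set.Icc (t0 - δ) (t0 + δ) := ⟨by linarith, by linarith⟩
  have hpl : IsPicardLindelof f (tmin := t0 - δ) (tmax := t0 + δ) ⟨t0, hmem⟩ x0 a 0 (M' + K * a) K := by
    refine ⟨fun t _ => (hK t).lipschitzOnWith, fun x _ => (hc x).continuousOn, ?_, ?_⟩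
    · intro t ht x hx
      have h1 := (hK t).dist_le_mul x x0
      have h2 := hM t ht
      have h3 : ‖f t x‖ ≤ ‖f t x0‖ + dist (f t x) (f t x0) := by
        rw [dist_eq_norm]
        calc ‖f t x‖ = ‖f t x0 + (f t x - f t x0)‖ := by congr 1; abel
          _ ≤ _ := norm_add_le _ _
      have h4 : dist x x0 ≤ a := hx
      have h5 : M ≤ M' := le_max_left _ _
      push_cast
      nlinarith [mul_le_mul_of_nonneg_left h4 hK0]
    · have e1 : t0 + δ - t0 = δ := by ring
      have e2 : t0 - (t0 - δ) = δ := by ring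
      show ((M' + K * a : NNReal) : ℝ) * max (t0 + δ - t0) (t0 - (t0 - δ)) ≤ a - (0 : NNReal)
      rw [e1, e2, max_self]
      have ea : (a : ℝ) = 2 * M' * δ := rfl
      push_cast
      have hKδ : K * δ ≤ 1/2 := by
        rw [hδ]; rw [mul_one_div, div_le_div_iff₀ (by positivity) (by norm_num)]; linarith
      have hM0 : (0:ℝ) ≤ M' := M'.2
      rw [ea]
      have : (0:ℝ) ≤ M' * δ := by positivity
      nlinarith
  exact hpl.exists_eq_forall_mem_Icc_hasDerivWithinAt₀

lemma glue {f : ℝ → E → E} {a b c : ℝ} (hab : a ≤ b) (hbc : b ≤ c) {v w : ℝ → E}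
    (hv : ∀ t ∈ Set.Icc a b, HasDerivWithinAt v (f t (v t)) (Set.Icc a b) t)
    (hw : ∀ t ∈ Set.Icc b c, HasDerivWithinAt w (f t (w t)) (Set.Icc b c) t) (h : v b = w b) :
    ∃ z : ℝ → E, (∀ t ≤ b, z t = v t) ∧
      ∀ t ∈ Set.Icc a c, HasDerivWithinAt z (f t (z t)) (Set.Icc a c) t := by
  classical
  refine ⟨fun t => if t ≤ b then v t else w t, fun t ht => if_pos ht, ?_⟩
  set z : ℝ → E := fun t => if t ≤ b then v t else w t with hz
  have z1 : ∀ t ≤ b, z t = v t := fun t ht => if_pos ht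
  have z2 : ∀ t, b ≤ t → z t = w t := by
    intro t ht
    rcases eq_or_lt_of_le ht with h' | h'
    · subst h'; rw [z1 _ le_rfl, h]
    · exact if_neg (not_le.2 h')
  have A : ∀ t ∈ Set.Icc a b, HasDerivWithinAt z (f t (z t)) (Set.Icc a b) t := by
    intro t ht
    rw [z1 t ht.2]
    exact (hv t ht).congr (fun s hs => z1 s hs.2) (z1 t ht.2)
  have B : ∀ t ∈ Set.Icc b c, HasDerivWithinAt z (f t (z t)) (Set.Icc b c) t := by
    intro t ht
    rw [z2 t ht.1]
    exact (hw t ht).congr (fun s hs => z2 s hs.1) (z2 t ht.1)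
  intro t ht
  rw [← Set.Icc_union_Icc_eq_Icc hab hbc]
  rcases lt_trichotomy t b with h' | h' | h'
  · refine (A t ⟨ht.1, h'.le⟩).union ?_
    refine hasDerivWithinAt_iff_hasFDerivWithinAt.2 (HasFDerivWithinAt.of_notMem_closure ?_)
    rw [closure_Icc]; exact fun hh => absurd hh.1 (not_le.2 h')
  · subst h'
    exact (A t ⟨hab, le_rfl⟩).union (B t ⟨le_rfl, hbc⟩)
  · refine HasDerivWithinAt.union ?_ (B t ⟨h'.le, ht.2⟩)
    refine hasDerivWithinAt_iff_hasFDerivWithinAt.2 (HasFDerivWithinAt.of_notMem_closure ?_)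
    rw [closure_Icc]; exact fun hh => absurd hh.2 (not_le.2 h')

lemma ode_forward (f : ℝ → E → E) (K : NNReal) (hK : ∀ t, LipschitzWith K (f t))
    (hc : ∀ x, Continuous (fun t => f t x)) (x0 : E) :
    ∃ v : ℝ → E, v 0 = x0 ∧ ∀ t ∈ Set.Icc (0:ℝ) 1,
      HasDerivWithinAt v (f t (v t)) (Set.Icc (0:ℝ) 1) t := by
  have hK0 : (0:ℝ) ≤ K := K.2
  have hδ0 : (0:ℝ) < 1/(2*(K+1)) := by positivity
  have key : ∀ n : ℕ, ∃ v : ℝ → E, v 0 = x0 ∧ ∀ t ∈ Set.Icc (0:ℝ) (n * (1/(2*(K+1)))),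
      HasDerivWithinAt v (f t (v t)) (Set.Icc (0:ℝ) (n * (1/(2*(K+1))))) t := by
    intro n
    induction n with
    | zero =>
      refine ⟨fun _ => x0, rfl, fun t ht => ?_⟩
      simp only [Nat.cast_zero, zero_mul, Set.Icc_self, Set.mem_singleton_iff] at ht ⊢
      subst ht
      exact hasDerivWithinAt_iff_hasFDerivWithinAt.2 (HasFDerivWithinAt.of_subsingleton (by simp))
    | succ n ih =>
      obtain ⟨v, v0, hv⟩ := ih
      obtain ⟨w, w0, hw⟩ := ode_local f K hK hc (n * (1/(2*(K+1)))) (v (n * (1/(2*(K+1)))))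
      have h0 : (0:ℝ) ≤ n * (1/(2*(K+1))) := by positivity
      obtain ⟨z, z1, z2⟩ := glue (f := f) (a := 0) (b := n * (1/(2*(K+1))))
        (c := n * (1/(2*(K+1))) + 1/(2*(K+1))) h0 (by linarith) hv
        (fun t ht => (hw t ⟨by linarith [ht.1], ht.2⟩).mono
          (fun s hs => ⟨by linarith [hs.1], hs.2⟩)) w0.symm
      refine ⟨z, by rw [z1 0 h0, v0], ?_⟩
      have e : ((n+1 : ℕ) : ℝ) * (1/(2*(K+1))) = n * (1/(2*(K+1))) + 1/(2*(K+1)) := by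
        push_cast; ring
      rw [e]; exact z2
  obtain ⟨n, hn⟩ := exists_nat_ge (1 / (1/(2*((K:ℝ)+1))))
  obtain ⟨v, v0, hv⟩ := key n
  rw [div_le_iff₀ hδ0] at hn
  exact ⟨v, v0, fun t ht => (hv t ⟨ht.1, ht.2.trans hn⟩).mono (fun s hs => ⟨hs.1, hs.2.trans hn⟩)⟩

lemma lin_ode (A : ℝ → E →L[ℝ] E) (hA : ContinuousOn A (Set.Icc 0 1)) (x0 : E) :
    ∃ v : ℝ → E, v 0 = x0 ∧ ∀ t ∈ Set.Icc (0:ℝ) 1,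
      HasDerivWithinAt v (A t (v t)) (Set.Icc (0:ℝ) 1) t := by
  obtain ⟨M, hM⟩ := isCompact_Icc.exists_bound_of_continuousOn hA
  set B : ℝ → E →L[ℝ] E := Set.IccExtend (zero_le_one' ℝ) (fun t => A t) with hB
  have hBc : Continuous B := (continuousOn_iff_continuous_domRestrict.1 hA).Icc_extend'
  have hBM : ∀ t, ‖B t‖ ≤ M := fun t => hM _ (Subtype.coe_prop _)
  have hM0 : 0 ≤ M := (norm_nonneg _).trans (hBM 0)
  obtain ⟨v, v0, hv⟩ := ode_forward (fun t x => B t x) ⟨M, hM0⟩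
    (fun t => (B t).lipschitz.weaken (hBM t)) (fun x => by fun_prop) x0
  refine ⟨v, v0, fun t ht => ?_⟩
  have : B t = A t := Set.IccExtend_of_mem _ _ ht
  rw [← this]; exact hv t ht

lemma global_curve (X : E → E) (hX : ContDiff ℝ 1 X) (K : NNReal) (hK : LipschitzWith K X) (x : E) :
    ∃ γ : ℝ → E, γ 0 = x ∧ ∀ t, HasDerivAt γ (X (γ t)) t := by
  have hX' : ContMDiff (modelWithCornersSelf ℝ E) (modelWithCornersSelf ℝ E).tangent 1
      (fun x => (⟨x, X x⟩ : TangentBundle (modelWithCornersSelf ℝ E) E)) :=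
    contMDiff_vectorSpace_iff_contDiff.2 hX
  have hδ0 : (0:ℝ) < 1/(2*(K+1)) := by
    have : (0:ℝ) ≤ K := K.2
    positivity
  have loc : ∀ x : E, ∃ γ : ℝ → E, γ 0 = x ∧
      IsMIntegralCurveOn (I := modelWithCornersSelf ℝ E) γ X
        (Set.Ioo (-(1/(2*((K:ℝ)+1)))) (1/(2*((K:ℝ)+1)))) := by
    intro x
    obtain ⟨v, v0, hv⟩ := ode_local (fun _ => X) K (fun _ => hK) (fun _ => continuous_const) 0 x
    refine ⟨v, v0, ?_⟩
    intro t ht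
    rw [zero_sub, zero_add] at hv
    have h1 : HasDerivWithinAt v (X (v t)) (Set.Ioo (-(1/(2*((K:ℝ)+1)))) (1/(2*((K:ℝ)+1)))) t :=
      (hv t (Set.Ioo_subset_Icc_self ht)).mono Set.Ioo_subset_Icc_self
    have h2 := h1.hasFDerivWithinAt.hasMFDerivWithinAt
    exact h2
  obtain ⟨γ, h0, h⟩ := exists_isMIntegralCurve_of_isMIntegralCurveOn hX' hδ0 loc x
  refine ⟨γ, h0, fun t => ?_⟩
  exact hasDerivAt_iff_hasFDerivAt.2 (h t).hasFDerivAt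

lemma global_flow (X : SM E E) (K : NNReal) (hK : LipschitzWith K X) :
    ∃ φ : ℝ → E → E, (∀ x, φ 0 x = x) ∧ ∀ x t, HasDerivAt (fun s => φ s x) (X (φ t x)) t := by
  have h := fun x => global_curve X (X.smooth.of_le (by norm_cast)) K hK x
  choose φ h0 h1 using h
  exact ⟨fun t x => φ x t, h0, h1⟩

end ODE

end HamReach
end

end Part2

section Part3
open MeasureTheory Real

open Filter Topology

noncomputable section

namespace HamReach

section Chernoff

/-- Iterates of a smooth map. -/
def SM.iter {E : Type} [NormedAddCommGroup E] [NormedSpace ℝ E] (G : SM E E) : ℕ → SM E E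
  | 0 => SM.id
  | n + 1 => G.comp (SM.iter G n)

variable {E F : Type} [NormedAddCommGroup E] [NormedSpace ℝ E]
  [NormedAddCommGroup F] [NormedSpace ℝ F]

lemma SM.T_iter (G : SM E E) (n : ℕ) : SM.T (G.iter n) = (SM.T G).iter n := by
  induction n with
  | zero => exact SM.T_id
  | succ n ih => show SM.T (G.comp (G.iter n)) = (SM.T G).comp ((SM.T G).iter n)
                 rw [SM.T_comp, ih]

/-- `ψ` is the time-one map of `X` with initial conditions given by `j`. -/
def Sol (X : SM F F) (j : SM E F) (ψ : E → F) : Prop :=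
  ∀ x, ∃ γ : ℝ → F, γ 0 = j x ∧
    (∀ t ∈ Set.Icc (0:ℝ) 1, HasDerivWithinAt γ (X (γ t)) (Set.Icc (0:ℝ) 1) t) ∧ γ 1 = ψ x

lemma gron {e : ℕ → ℝ} {K η h : ℝ} {N : ℕ} (hK : 0 ≤ K) (hη : 0 ≤ η) (hh : 0 ≤ h)
    (he0 : 0 ≤ e 0) (D : ℝ) (hD : (e 0 + η * (h * N)) * Real.exp (K * (h * N)) ≤ D)
    (hstep : ∀ k < N, e k ≤ D → e (k+1) ≤ (1 + h * K) * e k + h * η) :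
    ∀ k ≤ N, e k ≤ (e 0 + η * (h * k)) * Real.exp (K * (h * k)) := by
  intro k
  induction k with
  | zero => intro _; simp
  | succ k ih =>
    intro hk
    have h1 := ih (by omega)
    have h2 : e k ≤ D := by
      refine h1.trans (le_trans ?_ hD)
      have : (k:ℝ) ≤ N := by exact_mod_cast (by omega : k ≤ N)
      gcongr
    have h3 := hstep k (by omega) h2
    have h4 : 1 + h * K ≤ Real.exp (K * h) := by
      have := Real.add_one_le_exp (K * h); linarith
    have h5 : Real.exp (K * (h * (k+1 : ℕ))) = Real.exp (K*h) * Real.exp (K * (h * k)) := by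
      rw [← Real.exp_add]; push_cast; congr 1; ring
    have h6 : 1 ≤ Real.exp (K * (h * (k+1 : ℕ))) := Real.one_le_exp (by positivity)
    have h7 : 0 ≤ (e 0 + η * (h * k)) * Real.exp (K * (h * k)) := by positivity
    calc e (k+1) ≤ (1 + h * K) * e k + h * η := h3
      _ ≤ (1 + h * K) * ((e 0 + η * (h * k)) * Real.exp (K * (h * k))) + h * η := by gcongr
      _ ≤ Real.exp (K*h) * ((e 0 + η * (h * k)) * Real.exp (K * (h * k))) +
            h * η * Real.exp (K * (h * (k+1 : ℕ))) := by
          have : h * η ≤ h * η * Real.exp (K * (h * (k+1 : ℕ))) :=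
            le_mul_of_one_le_right (by positivity) h6
          gcongr
      _ = _ := by rw [h5]; push_cast; ring

lemma curve_consistency {γ : ℝ → F} {X : SM F F}
    (hγ : ∀ t ∈ Set.Icc (0:ℝ) 1, HasDerivWithinAt γ (X (γ t)) (Set.Icc (0:ℝ) 1) t)
    {η : ℝ} (hη : 0 < η) :
    ∃ δ > 0, ∀ t h : ℝ, 0 ≤ t → 0 ≤ h → h < δ → t + h ≤ 1 →
      ‖γ (t+h) - γ t - h • X (γ t)‖ ≤ h * η := by
  have hc : ContinuousOn γ (Set.Icc (0:ℝ) 1) := fun t ht => (hγ t ht).continuousWithinAt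
  have hXc : ContinuousOn (fun t => X (γ t)) (Set.Icc (0:ℝ) 1) := X.continuous.comp_continuousOn hc
  have huc := isCompact_Icc.uniformContinuousOn_of_continuous hXc
  obtain ⟨δ, hδ, H⟩ := Metric.uniformContinuousOn_iff.1 huc η hη
  refine ⟨δ, hδ, fun t h ht hh hhδ hth => ?_⟩
  have key := (convex_Icc t (t+h)).norm_image_sub_le_of_norm_hasDerivWithin_le
    (f := fun s => γ s - s • X (γ t)) (f' := fun s => X (γ s) - X (γ t)) (C := η)
    (fun s hs => by
      have hs' : s ∈ Set.Icc (0:ℝ) 1 := ⟨ht.trans hs.1, hs.2.trans hth⟩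
      have h1 := (hγ s hs').mono (s := Set.Icc t (t+h))
        (Set.Icc_subset_Icc ht hth)
      have h2 : HasDerivWithinAt (fun s : ℝ => s • X (γ t)) ((1:ℝ) • X (γ t)) (Set.Icc t (t+h)) s :=
        (hasDerivWithinAt_id s _).smul_const _
      rw [one_smul] at h2
      exact h1.sub h2)
    (fun s hs => by
      have hs' : s ∈ Set.Icc (0:ℝ) 1 := ⟨ht.trans hs.1, hs.2.trans hth⟩
      have := H s hs' t ⟨ht, by linarith⟩ (by
        rw [Real.dist_eq, abs_of_nonneg (by linarith [hs.1])]; linarith [hs.2])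
      rw [dist_eq_norm] at this
      exact this.le)
    (x := t) (y := t + h) ⟨le_rfl, by linarith⟩ ⟨by linarith, le_rfl⟩
  have e : γ (t+h) - (t+h) • X (γ t) - (γ t - t • X (γ t)) = γ (t+h) - γ t - h • X (γ t) := by
    rw [add_smul]; abel
  simp only [e] at key
  rw [add_sub_cancel_left, Real.norm_eq_abs, abs_of_nonneg hh] at key
  linarith

lemma chernoff_core [FiniteDimensional ℝ F] {X : SM F F} {j : SM E F} {ψ : E → F}
    (hs : Sol X j ψ) {ι : Type*} {l : Filter ι} {G : ι → SM F F} {n : ι → ℕ}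
    (hn : Tendsto n l atTop) (hG : TK 0 l (fun i => (n i : ℝ) • (G i - SM.id)) X)
    (x0 : E) {ε : ℝ} (hε : 0 < ε) :
    ∃ N ∈ 𝓝 x0, ∀ᶠ i in l, ∀ x ∈ N, ‖(G i).iter (n i) (j x) - ψ x0‖ < ε := by
  obtain ⟨γ, γ0, hγ, γ1⟩ := hs x0
  have hc : ContinuousOn γ (Set.Icc (0:ℝ) 1) := fun t ht => (hγ t ht).continuousWithinAt
  obtain ⟨R, hR⟩ := isCompact_Icc.exists_bound_of_continuousOn hc
  set B := Metric.closedBall (0:F) (R+1) with hB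
  have hBc : IsCompact B := isCompact_closedBall _ _
  have hXd : Continuous (fderiv ℝ X) := X.smooth.continuous_fderiv (by simp)
  obtain ⟨K, hK⟩ := hBc.exists_bound_of_continuousOn hXd.continuousOn
  have hR0 : 0 ≤ R := (norm_nonneg _).trans (hR 0 ⟨le_rfl, zero_le_one⟩)
  have hK0 : 0 ≤ K := (norm_nonneg _).trans (hK 0 (by simp [hB]; linarith))
  have hLip : ∀ x ∈ B, ∀ y ∈ B, ‖X y - X x‖ ≤ K * ‖y - x‖ := fun x hx y hy =>
    (convex_closedBall (0:F) (R+1)).norm_image_sub_le_of_norm_fderiv_le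
      (fun z _ => X.differentiable z) hK hx hy
  set D := min 1 (ε/2) with hD
  have hD0 : 0 < D := by positivity
  set η := D / (3 * Real.exp K) with hη
  have hη0 : 0 < η := by positivity
  have hηD : (η + 2 * η) * Real.exp K = D := by rw [hη]; field_simp; ring
  obtain ⟨δ, hδ, hcons⟩ := curve_consistency hγ hη0
  rw [TK_zero, ContinuousMap.tendsto_iff_forall_isCompact_tendstoUniformlyOn] at hG
  have hGB := Metric.tendstoUniformlyOn_iff.1 (hG B hBc) η hη0
  have hN : ∀ᶠ x in 𝓝 x0, ‖j x - j x0‖ < η := by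
    have := j.continuous.tendsto x0
    rw [tendsto_iff_norm_sub_tendsto_zero] at this
    exact this.eventually (gt_mem_nhds hη0)
  refine ⟨{x | ‖j x - j x0‖ < η}, hN, ?_⟩
  have hn1 : ∀ᶠ i in l, 1/δ < n i := by
    exact (tendsto_natCast_atTop_atTop.comp hn).eventually (eventually_gt_atTop _)
  filter_upwards [hGB, hn1] with i hi hni x hx
  have hnpos : (0:ℝ) < n i := lt_trans (by positivity) hni
  set h : ℝ := 1 / n i with hh
  have hh0 : 0 < h := by positivity
  have hhδ : h < δ := by
    rw [hh, div_lt_iff₀ hnpos]; rw [div_lt_iff₀ hδ] at hni; linarith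
  have hhn : h * n i = 1 := by rw [hh]; field_simp
  set e : ℕ → ℝ := fun k => ‖(G i).iter k (j x) - γ (h * k)‖ with he
  have e0 : e 0 < η := by
    simp only [he, Nat.cast_zero, mul_zero, γ0]; exact hx
  have hDle : (e 0 + 2*η * (h * n i)) * Real.exp (K * (h * n i)) ≤ D := by
    rw [hhn, mul_one, mul_one, ← hηD]; gcongr
  have main := gron (e := e) (K := K) (η := 2*η) (h := h) (N := n i) hK0 (by positivity) hh0.le
    (norm_nonneg _) D hDle (by
    intro k hk hek
    set y := (G i).iter k (j x) with hy
    have hk1 : h * k + h ≤ 1 := by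
      have : ((k:ℝ)+1) ≤ n i := by exact_mod_cast hk
      calc h * k + h = h * (k+1) := by ring
        _ ≤ h * n i := by gcongr
        _ = 1 := hhn
    have hk0 : 0 ≤ h * k := by positivity
    have hg : ‖γ (h*k)‖ ≤ R := hR _ ⟨hk0, by linarith⟩
    have hgB : γ (h*k) ∈ B := by simp only [hB, mem_closedBall_zero_iff]; linarith
    have hek' : ‖y - γ (h*k)‖ ≤ D := hek
    have hyB : y ∈ B := by
      simp only [hB, mem_closedBall_zero_iff]
      have h1 : ‖y‖ ≤ ‖y - γ (h*k)‖ + ‖γ (h*k)‖ := by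
        simpa using norm_add_le (y - γ (h*k)) (γ (h*k))
      have h2 : D ≤ 1 := min_le_left _ _
      linarith
    have h1 := hi y hyB
    rw [dist_eq_norm] at h1
    change ‖X y - (n i : ℝ) • (G i y - y)‖ < η at h1
    have h2 := hcons (h*k) h hk0 hh0.le hhδ hk1
    have h3 := hLip _ hgB _ hyB
    have e1 : (G i).iter (k+1) (j x) = G i y := rfl
    have e2 : h * ((k+1 : ℕ):ℝ) = h*k + h := by push_cast; ring
    have e3 : G i y = y + h • ((n i : ℝ) • (G i y - y)) := by
      rw [smul_smul, hhn, one_smul]; abel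
    show ‖(G i).iter (k+1) (j x) - γ (h * ((k+1:ℕ):ℝ))‖ ≤ (1 + h*K) * ‖y - γ (h*k)‖ + h * (2*η)
    rw [e1, e2]
    have e4 : G i y - γ (h*k+h) = (y - γ (h*k)) + h • (X y - X (γ (h*k))) +
        -(h • (X y - (n i : ℝ) • (G i y - y))) + -(γ (h*k+h) - γ (h*k) - h • X (γ (h*k))) := by
      conv_lhs => rw [e3]
      simp only [smul_sub]; abel
    rw [e4]
    have n1 : ‖h • (X y - X (γ (h*k)))‖ ≤ h * (K * ‖y - γ (h*k)‖) := by
      rw [norm_smul, Real.norm_eq_abs, abs_of_pos hh0]; gcongr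
    have n2 : ‖-(h • (X y - (n i : ℝ) • (G i y - y)))‖ ≤ h * η := by
      rw [norm_neg, norm_smul, Real.norm_eq_abs, abs_of_pos hh0]; gcongr
    have n3 : ‖-(γ (h*k+h) - γ (h*k) - h • X (γ (h*k)))‖ ≤ h * η := by
      rw [norm_neg]; exact h2
    have := norm_add_le ((y - γ (h*k)) + h • (X y - X (γ (h*k))) +
        -(h • (X y - (n i : ℝ) • (G i y - y)))) (-(γ (h*k+h) - γ (h*k) - h • X (γ (h*k))))
    have := norm_add_le ((y - γ (h*k)) + h • (X y - X (γ (h*k))))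
        (-(h • (X y - (n i : ℝ) • (G i y - y))))
    have := norm_add_le (y - γ (h*k)) (h • (X y - X (γ (h*k))))
    linarith) (n i) le_rfl
  have hfin := main.trans hDle
  simp only [he, hhn, γ1] at hfin
  have : D ≤ ε/2 := min_le_right _ _
  linarith

/-- Euler scheme. -/
def euler (X : SM F F) (n : ℕ) : SM F F := SM.id + (1 / (n + 1 : ℝ)) • X

lemma euler_eq (X : SM F F) (n : ℕ) : ((n+1 : ℕ) : ℝ) • (euler X n - SM.id) = X := by
  unfold euler
  rw [add_sub_cancel_left, smul_smul]
  have : ((n+1 : ℕ) : ℝ) * (1 / (n+1)) = 1 := by push_cast; field_simp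
  rw [this, one_smul]

lemma euler_tendsto (X : SM F F) (k : ℕ) :
    TK k atTop (fun n : ℕ => ((n+1 : ℕ) : ℝ) • (euler X n - SM.id)) X := by
  simp only [euler_eq]; exact TK_const _

lemma succ_tendsto : Tendsto (fun n : ℕ => n+1) atTop atTop := tendsto_add_atTop_nat 1

lemma Sol.continuous [FiniteDimensional ℝ F] {X : SM F F} {j : SM E F} {ψ : E → F}
    (hs : Sol X j ψ) : Continuous ψ := by
  rw [Metric.continuous_iff']
  intro x0 ε hε
  obtain ⟨N, hN, H⟩ := chernoff_core hs succ_tendsto (euler_tendsto X 0) x0 (half_pos hε)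
  filter_upwards [hN] with x hx
  have : ‖ψ x - ψ x0‖ ≤ ε/2 := by
    refine le_of_forall_pos_le_add fun r hr => ?_
    obtain ⟨N', hN', H'⟩ := chernoff_core hs succ_tendsto (euler_tendsto X 0) x hr
    obtain ⟨i, h1, h2⟩ := (H.and H').exists
    have h1 := h1 x hx
    have h2 := h2 x (mem_of_mem_nhds hN')
    rw [norm_sub_rev] at h2
    have := norm_sub_le_norm_sub_add_norm_sub (ψ x) ((euler X i).iter (i+1) (j x)) (ψ x0)
    linarith
  rw [dist_eq_norm]; linarith

lemma Sol.tendstoLocallyUniformly [FiniteDimensional ℝ F] {X : SM F F} {j : SM E F} {ψ : E → F}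
    (hs : Sol X j ψ) {ι : Type*} {l : Filter ι} {G : ι → SM F F} {n : ι → ℕ}
    (hn : Tendsto n l atTop) (hG : TK 0 l (fun i => (n i : ℝ) • (G i - SM.id)) X) :
    TendstoLocallyUniformly (fun i x => (G i).iter (n i) (j x)) ψ l := by
  rw [Metric.tendstoLocallyUniformly_iff]
  intro ε hε x0
  obtain ⟨N, hN, H⟩ := chernoff_core hs hn hG x0 (half_pos hε)
  have h2 := Metric.continuous_iff'.1 hs.continuous x0 (ε/2) (half_pos hε)
  refine ⟨_, inter_mem hN h2, ?_⟩
  filter_upwards [H] with i hi x hx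
  have h1 := hi x hx.1
  have h2 : dist (ψ x) (ψ x0) < ε/2 := hx.2
  rw [← dist_eq_norm, dist_comm] at h1
  linarith [dist_triangle (ψ x) (ψ x0) ((G i).iter (n i) (j x))]

lemma Sol.prolong [FiniteDimensional ℝ F] {X : SM F F} {j : SM E F} {ψ : E → F}
    (hs : Sol X j ψ) : ∃ ψ1 : E × E → F × F, Sol (SM.T X) (SM.T j) ψ1 ∧ ∀ z, (ψ1 z).1 = ψ z.1 := by
  have : CompleteSpace F := FiniteDimensional.complete ℝ F
  choose γ γ0 hγ γ1 using hs
  have hXd : Continuous (fderiv ℝ X) := X.smooth.continuous_fderiv (by simp)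
  have : ∀ z : E × E, ∃ v : ℝ → F, v 0 = fderiv ℝ j z.1 z.2 ∧ ∀ t ∈ Set.Icc (0:ℝ) 1,
      HasDerivWithinAt v (fderiv ℝ X (γ z.1 t) (v t)) (Set.Icc (0:ℝ) 1) t := fun z =>
    lin_ode (fun t => fderiv ℝ X (γ z.1 t))
      (hXd.comp_continuousOn fun t ht => (hγ z.1 t ht).continuousWithinAt) _
  choose v v0 hv using this
  refine ⟨fun z => (γ z.1 1, v z 1), fun z => ⟨fun t => (γ z.1 t, v z t), ?_, ?_, rfl⟩,
    fun z => γ1 z.1⟩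
  · simp [γ0, v0]
  · intro t ht
    exact (hγ z.1 t ht).prodMk (hv z t ht)

lemma tlu_sum {κ ι : Type*} (s : Finset κ) (f : κ → ι → E → F) (g : κ → E → F) {l : Filter ι}
    (h : ∀ k, TendstoLocallyUniformly (f k) (g k) l) :
    TendstoLocallyUniformly (fun i x => ∑ k ∈ s, f k i x) (fun x => ∑ k ∈ s, g k x) l := by
  classical
  induction s using Finset.induction_on with
  | empty =>
    simp only [Finset.sum_empty]
    exact fun u hu x => ⟨Set.univ, univ_mem, Eventually.of_forall fun i y _ => refl_mem_uniformity hu⟩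
  | insert a s ha ih =>
    simp only [Finset.sum_insert ha]
    exact (h a).add ih

lemma Sol.hasFDerivAt [FiniteDimensional ℝ E] [FiniteDimensional ℝ F] {X : SM F F} {j : SM E F}
    {ψ : E → F} (hs : Sol X j ψ) {ψ1 : E × E → F × F} (h1 : Sol (SM.T X) (SM.T j) ψ1) (x : E) :
    DifferentiableAt ℝ ψ x ∧ ∀ v, fderiv ℝ ψ x v = (ψ1 (x, v)).2 := by
  set f : ℕ → SM E F := fun n => ((euler X n).iter (n+1)).comp j with hf
  have hu0 : TendstoLocallyUniformly (fun n x => f n x) ψ atTop :=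
    hs.tendstoLocallyUniformly succ_tendsto (euler_tendsto X 0)
  have hu1 : TendstoLocallyUniformly (fun n z => SM.T (f n) z) ψ1 atTop := by
    have := h1.tendstoLocallyUniformly (G := fun n => SM.T (euler X n)) succ_tendsto (by
      have := TK_succ.1 (euler_tendsto X 1)
      simpa [map_smul, map_sub, SM.T_id] using this)
    have e : ∀ n, SM.T (f n) = ((SM.T (euler X n)).iter (n+1)).comp (SM.T j) := fun n => by
      rw [hf]; simp only [SM.T_comp, SM.T_iter]
    simpa [e] using this
  let b := Module.finBasis ℝ E
  let c : Fin (Module.finrank ℝ E) → (E →L[ℝ] ℝ) := fun i => LinearMap.toContinuousLinearMap (b.coord i)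
  let L : (Fin (Module.finrank ℝ E) → F) → (E →L[ℝ] F) := fun w => ∑ i, (c i).smulRight (w i)
  have hL : Continuous L := by
    refine continuous_finsetSum _ fun i _ => ?_
    exact (ContinuousLinearMap.smulRightL ℝ E F (c i)).continuous.comp (continuous_apply i)
  have hLA : ∀ A : E →L[ℝ] F, A = L (fun i => A (b i)) := by
    intro A
    ext y
    conv_lhs => rw [← b.sum_repr y, map_sum]
    simp [L, c]
  have hpt : ∀ x v, Tendsto (fun n => fderiv ℝ (f n) x v) atTop (𝓝 (ψ1 (x, v)).2) := by
    intro x v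
    have := (continuous_snd.tendsto _).comp
      ((tendstoLocallyUniformlyOn_univ.2 hu1).tendsto_at (Set.mem_univ (x,v)))
    exact this
  let g' : E → E →L[ℝ] F := fun x => L (fun i => (ψ1 (x, b i)).2)
  have hg' : ∀ x v, g' x v = (ψ1 (x,v)).2 := by
    intro x v
    have t1 : Tendsto (fun n => fderiv ℝ (f n) x) atTop (𝓝 (g' x)) := by
      have := (hL.tendsto (fun i => (ψ1 (x, b i)).2)).comp
        (tendsto_pi_nhds.2 fun i => hpt x (b i))
      refine this.congr fun n => (hLA _).symm
    have t2 : Tendsto (fun n => fderiv ℝ (f n) x v) atTop (𝓝 (g' x v)) :=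
      ((ContinuousLinearMap.apply ℝ F v).continuous.tendsto _).comp t1
    exact tendsto_nhds_unique t2 (hpt x v)
  have hu : TendstoLocallyUniformlyOn (fun n x => fderiv ℝ (f n) x) g' atTop Set.univ := by
    rw [tendstoLocallyUniformlyOn_univ]
    have hi : ∀ i, TendstoLocallyUniformly
        (fun n x => (c i).smulRight (fderiv ℝ (f n) x (b i)))
        (fun x => (c i).smulRight (ψ1 (x, b i)).2) atTop := by
      intro i
      have h2 := hu1.comp (fun x : E => (x, b i)) (by fun_prop)
      have h3 := uniformContinuous_snd.comp_tendstoLocallyUniformly h2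
      exact (ContinuousLinearMap.smulRightL ℝ E F (c i)).uniformContinuous.comp_tendstoLocallyUniformly h3
    have hsum := tlu_sum Finset.univ _ _ hi
    have e : (fun n x => fderiv ℝ (f n) x) =
        fun n x => ∑ i, (c i).smulRight (fderiv ℝ (f n) x (b i)) := by
      funext n x; exact hLA _
    rw [e]; exact hsum
  have := hasFDerivAt_of_tendstoLocallyUniformlyOn isOpen_univ hu
    (fun n x _ => ((f n).differentiable x).hasFDerivAt)
    (fun x _ => (tendstoLocallyUniformlyOn_univ.2 hu0).tendsto_at (Set.mem_univ x)) (Set.mem_univ x)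
  exact ⟨this.differentiableAt, fun v => by rw [this.fderiv, hg']⟩

lemma Sol.contDiff (k : ℕ) [FiniteDimensional ℝ E] [FiniteDimensional ℝ F] {X : SM F F}
    {j : SM E F} {ψ : E → F} (hs : Sol X j ψ) : ContDiff ℝ k ψ := by
  induction k generalizing E F with
  | zero => exact_mod_cast contDiff_zero.2 hs.continuous
  | succ k ih =>
    obtain ⟨ψ1, h1, -⟩ := hs.prolong
    have hd := hs.hasFDerivAt h1
    have h2 := ih h1
    push_cast
    rw [contDiff_succ_iff_fderiv_apply]
    refine ⟨fun x => (hd x).1, by simp, fun v => ?_⟩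
    have e : (fun x => fderiv ℝ ψ x v) = fun x => (ψ1 (x, v)).2 := funext fun x => (hd x).2 v
    rw [e]
    exact (h2.comp (contDiff_id.prodMk contDiff_const)).snd

lemma Sol.smooth [FiniteDimensional ℝ E] [FiniteDimensional ℝ F] {X : SM F F}
    {j : SM E F} {ψ : E → F} (hs : Sol X j ψ) : ContDiff ℝ (⊤ : ℕ∞) ψ :=
  contDiff_infty.2 fun k => hs.contDiff k

lemma Sol.T [FiniteDimensional ℝ E] [FiniteDimensional ℝ F] {X : SM F F}
    {j : SM E F} {ψ : SM E F} (hs : Sol X j ψ) : Sol (SM.T X) (SM.T j) (SM.T ψ) := by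
  obtain ⟨ψ1, h1, h2⟩ := hs.prolong
  have hd := hs.hasFDerivAt h1
  have e : (SM.T ψ : E × E → F × F) = ψ1 := by
    funext z
    rw [SM.T_apply]
    exact Prod.ext (h2 z).symm ((hd z.1).2 z.2)
  rw [e]; exact h1

lemma Sol.TK (k : ℕ) [FiniteDimensional ℝ E] [FiniteDimensional ℝ F] {X : SM F F}
    {j : SM E F} {ψ : SM E F} (hs : Sol X j ψ)
    {ι : Type*} {l : Filter ι} {G : ι → SM F F} {n : ι → ℕ}
    (hn : Tendsto n l atTop) (hG : TK k l (fun i => (n i : ℝ) • (G i - SM.id)) X) :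
    TK k l (fun i => ((G i).iter (n i)).comp j) ψ := by
  induction k generalizing E F with
  | zero =>
    rw [TK_zero]
    exact ContinuousMap.tendsto_of_tendstoLocallyUniformly (hs.tendstoLocallyUniformly hn hG)
  | succ k ih =>
    rw [TK_succ] at hG ⊢
    simp only [SM.T_comp, SM.T_iter]
    refine ih hs.T ?_
    simpa [map_smul, map_sub, SM.T_id] using hG

/-- Chernoff product formula in the smooth topology. -/
theorem chernoff [FiniteDimensional ℝ E] [FiniteDimensional ℝ F] {X : SM F F}
    {j : SM E F} {ψ : SM E F} (hs : Sol X j ψ)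
    {ι : Type*} {l : Filter ι} {G : ι → SM F F} {n : ι → ℕ}
    (hn : Tendsto n l atTop)
    (hG : Tendsto (fun i => (n i : ℝ) • (G i - SM.id)) l (𝓝 X)) :
    Tendsto (fun i => ((G i).iter (n i)).comp j) l (𝓝 ψ) := by
  rw [tendsto_iff_TK] at hG ⊢
  exact fun k => hs.TK k hn (hG k)

end Chernoff

end HamReach
end

end Part3

section Part4
open MeasureTheory Real

open Filter Topology

noncomputable section

namespace HamReach

section Density

variable {E F G : Type} [NormedAddCommGroup E] [NormedSpace ℝ E]
  [NormedAddCommGroup F] [NormedSpace ℝ F] [NormedAddCommGroup G] [NormedSpace ℝ G]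

/-- Locality of the `C^k` topologies. -/
lemma TK_local (k : ℕ) {ι : Type*} {l : Filter ι} {f : ι → SM E F} {f₀ : SM E F}
    (h : ∀ R : ℝ, ∃ (g : ι → SM E F) (g₀ : SM E F), TK k l g g₀ ∧
      (∀ i, ∀ x ∈ Metric.ball (0:E) R, f i x = g i x) ∧ ∀ x ∈ Metric.ball (0:E) R, f₀ x = g₀ x) :
    TK k l f f₀ := by
  induction k generalizing E F with
  | zero =>
    rw [TK_zero, ContinuousMap.tendsto_iff_forall_isCompact_tendstoUniformlyOn]
    intro K hK
    obtain ⟨R, hR⟩ := hK.isBounded.subset_ball (0:E)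
    obtain ⟨g, g₀, hg, e, e₀⟩ := h R
    rw [TK_zero, ContinuousMap.tendsto_iff_forall_isCompact_tendstoUniformlyOn] at hg
    refine ((hg K hK).congr ?_).congr_right ?_
    · exact Eventually.of_forall fun i x hx => (e i x (hR hx)).symm
    · exact fun x hx => (e₀ x (hR hx)).symm
  | succ k ih =>
    rw [TK_succ]
    refine ih fun R => ?_
    obtain ⟨g, g₀, hg, e, e₀⟩ := h R
    have aux : ∀ (a b : SM E F), (∀ x ∈ Metric.ball (0:E) R, a x = b x) →
        ∀ z ∈ Metric.ball (0:E×E) R, SM.T a z = SM.T b z := by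
      intro a b hab z hz
      have hz1 : z.1 ∈ Metric.ball (0:E) R := by
        rw [mem_ball_zero_iff] at hz ⊢; exact (norm_fst_le z).trans_lt hz
      have : (a : E → F) =ᶠ[𝓝 z.1] b :=
        Filter.eventually_of_mem (Metric.isOpen_ball.mem_nhds hz1) hab
      rw [SM.T_apply, SM.T_apply, this.fderiv_eq, hab _ hz1]
    exact ⟨_, _, TK_succ.1 hg, fun i => aux _ _ (e i), aux _ _ e₀⟩

/-- Derivative of a kernel in the first variable. -/
def dker (κ : SM (E × F) G) : SM ((E × E) × F) (G × G) :=
  SM.mk (fun z => SM.T κ ((z.1.1, z.2), (z.1.2, 0)))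
    ((SM.T κ).smooth.comp (by fun_prop))

lemma dker_apply (κ : SM (E × F) G) (z : (E × E) × F) :
    dker κ z = (κ (z.1.1, z.2), fderiv ℝ κ (z.1.1, z.2) (z.1.2, 0)) := rfl

variable [FiniteDimensional ℝ E] [FiniteDimensional ℝ F] [FiniteDimensional ℝ G]
  [MeasurableSpace F] [BorelSpace F]

variable (μ : Measure F) [IsFiniteMeasureOnCompacts μ]

/-- Integral operator over a compact set. -/
def iop (B : Set F) (κ : SM (E × F) G) (a : C(F, ℝ)) (x : E) : G := ∫ y in B, a y • κ (x, y) ∂μ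

lemma iop_hasFDerivAt {B : Set F} (hB : IsCompact B) (κ : SM (E × F) G) (a : C(F, ℝ)) (x : E) :
    DifferentiableAt ℝ (iop μ B κ a) x ∧
      ∀ v, fderiv ℝ (iop μ B κ a) x v = (iop μ B (dker κ) a (x, v)).2 := by
  have : CompleteSpace G := FiniteDimensional.complete ℝ G
  have hκd : Continuous (fderiv ℝ κ) := κ.smooth.continuous_fderiv (by simp)
  let F' : E → F → E →L[ℝ] G := fun x y =>
    a y • (fderiv ℝ κ (x, y)).comp (ContinuousLinearMap.inl ℝ E F)
  have hF'c : Continuous (fun z : E × F => F' z.1 z.2) := by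
    show Continuous (fun z : E × F => a z.2 • (fderiv ℝ κ (z.1, z.2)).comp (ContinuousLinearMap.inl ℝ E F))
    refine (a.continuous.comp continuous_snd).smul ?_
    exact (hκd.comp (continuous_fst.prodMk continuous_snd)).clm_comp continuous_const
  have hintG : ∀ {H : Type} [NormedAddCommGroup H] (f : F → H), Continuous f →
      IntegrableOn f B μ := fun f hf => hf.continuousOn.integrableOn_compact hB
  have hFc : ∀ x, Continuous (fun y => a y • κ (x, y)) := fun x =>
    a.continuous.smul (κ.continuous.comp (by fun_prop))
  obtain ⟨C, hC⟩ := ((isCompact_closedBall x 1).prod hB).exists_bound_of_continuousOn hF'c.continuousOn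
  have hd : HasFDerivAt (iop μ B κ a) (∫ y in B, F' x y ∂μ) x := by
    refine hasFDerivAt_integral_of_dominated_of_fderiv_le (μ := μ.restrict B)
      (F := fun x y => a y • κ (x, y)) (F' := F') (bound := fun _ => C)
      (Metric.closedBall_mem_nhds x zero_lt_one) ?_ ?_ ?_ ?_ ?_ ?_
    · exact Eventually.of_forall fun x => (hintG _ (hFc x)).aestronglyMeasurable
    · exact hintG _ (hFc x)
    · exact (hintG _ (hF'c.comp (Continuous.prodMk_right x))).aestronglyMeasurable
    · refine (ae_restrict_iff' hB.measurableSet).2 (Eventually.of_forall fun y hy z hz => ?_)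
      exact hC (z, y) ⟨hz, hy⟩
    · exact hintG _ continuous_const
    · refine Eventually.of_forall fun y z _ => ?_
      have h1 : HasFDerivAt (fun z : E => (z, y)) (ContinuousLinearMap.inl ℝ E F) z :=
        hasFDerivAt_prodMk_left z y
      exact ((κ.differentiable (z, y)).hasFDerivAt.comp z h1).const_smul (a y)
  refine ⟨hd.differentiableAt, fun v => ?_⟩
  have hF'x : IntegrableOn (fun y => F' x y) B μ := hintG _ (hF'c.comp (Continuous.prodMk_right x))
  rw [hd.fderiv, ContinuousLinearMap.integral_apply hF'x]
  have h2 : IntegrableOn (fun y => a y • dker κ ((x, v), y)) B μ :=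
    hintG _ (a.continuous.smul ((dker κ).continuous.comp (by fun_prop)))
  exact (ContinuousLinearMap.snd ℝ G G).integral_comp_comm h2

lemma iop_fst {B : Set F} (hB : IsCompact B) (κ : SM (E × F) G) (a : C(F, ℝ)) (z : E × E) :
    (iop μ B (dker κ) a z).1 = iop μ B κ a z.1 := by
  have : CompleteSpace G := FiniteDimensional.complete ℝ G
  have h2 : IntegrableOn (fun y => a y • dker κ (z, y)) B μ :=
    (a.continuous.smul ((dker κ).continuous.comp (by fun_prop))).continuousOn.integrableOn_compact hB
  exact ((ContinuousLinearMap.fst ℝ G G).integral_comp_comm h2).symm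

lemma iop_contDiff (k : ℕ) {B : Set F} (hB : IsCompact B) (κ : SM (E × F) G) (a : C(F, ℝ)) :
    ContDiff ℝ k (iop μ B κ a) := by
  induction k generalizing E G with
  | zero =>
    exact_mod_cast contDiff_zero.2
      (continuous_iff_continuousAt.2 fun x => (iop_hasFDerivAt μ hB κ a x).1.continuousAt)
  | succ k ih =>
    push_cast
    rw [contDiff_succ_iff_fderiv_apply]
    refine ⟨fun x => (iop_hasFDerivAt μ hB κ a x).1, by simp, fun v => ?_⟩
    have e : (fun x => fderiv ℝ (iop μ B κ a) x v) = fun x => (iop μ B (dker κ) a (x, v)).2 :=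
      funext fun x => (iop_hasFDerivAt μ hB κ a x).2 v
    rw [e]
    exact ((ih (dker κ)).comp (contDiff_id.prodMk contDiff_const)).snd

/-- The integral operator with values in smooth maps. -/
def siop {B : Set F} (hB : IsCompact B) (κ : SM (E × F) G) (a : C(F, ℝ)) : SM E G :=
  SM.mk (iop μ B κ a) (contDiff_infty.2 fun k => iop_contDiff μ k hB κ a)

lemma siop_T {B : Set F} (hB : IsCompact B) (κ : SM (E × F) G) (a : C(F, ℝ)) :
    SM.T (siop μ hB κ a) = siop μ hB (dker κ) a := by
  refine SM.ext fun z => ?_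
  rw [SM.T_apply]
  exact Prod.ext (iop_fst μ hB κ a z).symm ((iop_hasFDerivAt μ hB κ a z.1).2 z.2)

lemma siop_TK (k : ℕ) {B : Set F} (hB : IsCompact B) (κ : SM (E × F) G) {ι : Type*} {l : Filter ι}
    {a : ι → C(F, ℝ)} {a₀ : C(F, ℝ)} (ha : Tendsto a l (𝓝 a₀)) :
    TK k l (fun i => siop μ hB κ (a i)) (siop μ hB κ a₀) := by
  induction k generalizing E G with
  | zero =>
    rw [ContinuousMap.tendsto_iff_forall_isCompact_tendstoUniformlyOn] at ha
    rw [TK_zero, ContinuousMap.tendsto_iff_forall_isCompact_tendstoUniformlyOn]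
    intro K hK
    obtain ⟨C, hC⟩ := (hK.prod hB).exists_bound_of_continuousOn κ.continuous.continuousOn
    set C' := max C 0 with hC'
    have hμ : μ B < ⊤ := hB.measure_lt_top
    rw [Metric.tendstoUniformlyOn_iff]
    intro ε hε
    set η := ε / (2 * (C' * μ.real B + 1)) with hη
    have hpos : 0 < C' * μ.real B + 1 := by positivity
    have hη0 : 0 < η := by positivity
    filter_upwards [Metric.tendstoUniformlyOn_iff.1 (ha B hB) η hη0] with i hi x hx
    have hinteg : ∀ b : C(F, ℝ), IntegrableOn (fun y => b y • κ (x, y)) B μ := fun b =>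
      (b.continuous.smul (κ.continuous.comp (by fun_prop))).continuousOn.integrableOn_compact hB
    show dist (iop μ B κ a₀ x) (iop μ B κ (a i) x) < ε
    rw [dist_eq_norm, iop, iop, ← integral_sub (hinteg _) (hinteg _)]
    have : ‖∫ y in B, (a₀ y • κ (x, y) - a i y • κ (x, y)) ∂μ‖ ≤ (η * C') * μ.real B := by
      refine norm_setIntegral_le_of_norm_le_const hμ fun y hy => ?_
      rw [← sub_smul, norm_smul]
      have h1 := hi y hy
      rw [dist_eq_norm] at h1
      have h2 : ‖κ (x, y)‖ ≤ C' := (hC (x, y) ⟨hx, hy⟩).trans (le_max_left _ _)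
      gcongr
    have h3 : η * (C' * μ.real B + 1) = ε / 2 := by rw [hη]; field_simp
    nlinarith
  | succ k ih =>
    rw [TK_succ]
    simp only [siop_T]
    exact ih (dker κ)

/-- Exponentials of linear forms. -/
def expSM {F : Type} [NormedAddCommGroup F] [NormedSpace ℝ F] (l : F →L[ℝ] ℝ) : SM F ℝ :=
  SM.mk (fun x => Real.exp (l x)) (by fun_prop)

/-- Linear combinations of exponentials. -/
def expSpan (F : Type) [NormedAddCommGroup F] [NormedSpace ℝ F] : Submodule ℝ (SM F ℝ) :=
  Submodule.span ℝ (Set.range expSM)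

lemma exp_SW (f : SM F ℝ) : ∃ a : ℕ → SM F ℝ, (∀ n, a n ∈ expSpan F) ∧
    Tendsto (fun n => SM.toCM (a n)) atTop (𝓝 (SM.toCM f)) := by
  let S : Submonoid C(F, ℝ) :=
    { carrier := Set.range fun l : F →L[ℝ] ℝ => SM.toCM (expSM l)
      one_mem' := ⟨0, by ext x; simp [expSM]⟩
      mul_mem' := by
        rintro _ _ ⟨l, rfl⟩ ⟨m, rfl⟩
        exact ⟨l + m, by ext x; simp [expSM, Real.exp_add]⟩ }
  let A : Subalgebra ℝ C(F, ℝ) := Algebra.adjoin ℝ (S : Set C(F, ℝ))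
  have hA : ∀ g ∈ A, ∃ a ∈ expSpan F, SM.toCM a = g := by
    intro g hg
    have h1 : g ∈ Submodule.span ℝ (S : Set C(F, ℝ)) := by
      have : g ∈ Subalgebra.toSubmodule A := hg
      rw [Algebra.adjoin_eq_span, Submonoid.closure_eq] at this
      exact this
    have e : (S : Set C(F, ℝ)) = (SM.toCM : SM F ℝ →ₗ[ℝ] C(F, ℝ)) '' Set.range expSM := by
      rw [← Set.range_comp]; rfl
    rw [e, Submodule.span_image] at h1
    exact h1
  have hsep : A.SeparatesPoints := by
    intro x y hxy
    obtain ⟨l, hl⟩ := SeparatingDual.exists_separating_of_ne (R := ℝ) hxy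
    exact ⟨_, ⟨SM.toCM (expSM l), Algebra.subset_adjoin ⟨l, rfl⟩, rfl⟩,
      fun h => hl (Real.exp_injective h)⟩
  have : ∀ n : ℕ, ∃ a ∈ expSpan F, ∀ x ∈ Metric.closedBall (0:F) n, ‖a x - f x‖ < 1 / (n+1 : ℝ) := by
    intro n
    obtain ⟨g, hg, h⟩ := ContinuousMap.exists_mem_subalgebra_near_continuous_of_isCompact_of_separatesPoints
      hsep (SM.toCM f) (isCompact_closedBall (0:F) n) (ε := 1 / (n+1 : ℝ)) (by positivity)
    obtain ⟨a, ha, rfl⟩ := hA g hg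
    exact ⟨a, ha, h⟩
  choose a ha h using this
  refine ⟨a, ha, ?_⟩
  rw [ContinuousMap.tendsto_iff_forall_isCompact_tendstoUniformlyOn]
  intro K hK
  obtain ⟨R, hR⟩ := hK.isBounded.subset_closedBall (0:F)
  rw [Metric.tendstoUniformlyOn_iff]
  intro ε hε
  have h1 : ∀ᶠ n : ℕ in atTop, R ≤ n := tendsto_natCast_atTop_atTop.eventually (eventually_ge_atTop R)
  have h2 : ∀ᶠ n : ℕ in atTop, 1 / (n+1 : ℝ) < ε :=
    tendsto_one_div_add_atTop_nhds_zero_nat.eventually (gt_mem_nhds hε)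
  filter_upwards [h1, h2] with n hn1 hn2 x hx
  have := h n x (Metric.closedBall_subset_closedBall hn1 (hR hx))
  rw [dist_comm, dist_eq_norm]
  exact this.trans hn2

theorem exp_dense (f : SM F ℝ) : f ∈ closure (expSpan F : Set (SM F ℝ)) := by
  let μ : Measure F := Measure.addHaar
  let b : ContDiffBump (0:F) := ⟨1/2, 1, by norm_num, by norm_num⟩
  let ρ : SM F ℝ := SM.mk (b.normed μ) b.contDiff_normed
  have hB : IsCompact (Metric.closedBall (0:F) 1) := isCompact_closedBall _ _
  have hρ0 : ∀ y, y ∉ Metric.closedBall (0:F) 1 → ρ y = 0 := by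
    intro y hy
    by_contra hne
    have : y ∈ Function.support (b.normed μ) := hne
    rw [b.support_normed_eq] at this
    exact hy (Metric.ball_subset_closedBall this)
  have hρ1 : ∫ y in Metric.closedBall (0:F) 1, ρ y ∂μ = 1 := by
    rw [setIntegral_eq_integral_of_forall_compl_eq_zero hρ0]
    exact b.integral_normed
  let κ : SM F ℝ → SM ((ℝ × F) × F) ℝ := fun g =>
    SM.mk (fun z => g (z.1.2 - z.1.1 • z.2) * ρ z.2) (by
      have := g.smooth
      have := ρ.smooth
      fun_prop)
  let Γ : SM F ℝ → SM (ℝ × F) ℝ := fun g => siop μ hB (κ g) 1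
  have hΓ : ∀ g δ x, Γ g (δ, x) = ∫ y in Metric.closedBall (0:F) 1, g (x - δ • y) * ρ y ∂μ := by
    intro g δ x
    show ∫ y in Metric.closedBall (0:F) 1, (1:ℝ) • (g (x - δ • y) * ρ y) ∂μ = _
    simp
  have hinteg : ∀ (g : SM F ℝ) (δ : ℝ) (x : F),
      IntegrableOn (fun y => g (x - δ • y) * ρ y) (Metric.closedBall (0:F) 1) μ := fun g δ x =>
    ((g.continuous.comp (by fun_prop)).mul ρ.continuous).continuousOn.integrableOn_compact hB
  have i1 : (Γ f).comp (SM.ins 0) = f := by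
    refine SM.ext fun x => ?_
    rw [SM.comp_apply, SM.ins_apply, hΓ]
    simp only [zero_smul, sub_zero, integral_const_mul, hρ1, mul_one]
  have i2 : ∀ a ∈ expSpan F, ∀ δ : ℝ, (Γ a).comp (SM.ins δ) ∈ expSpan F := by
    intro a ha δ
    induction ha using Submodule.span_induction with
    | mem a ha =>
      obtain ⟨l, rfl⟩ := ha
      have : (Γ (expSM l)).comp (SM.ins δ) =
          (∫ y in Metric.closedBall (0:F) 1, Real.exp (- (δ * l y)) * ρ y ∂μ) • expSM l := by
        refine SM.ext fun x => ?_
        rw [SM.comp_apply, SM.ins_apply, hΓ, SM.smul_apply, smul_eq_mul, mul_comm, ← integral_const_mul]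
        congr 1
        funext y
        have e : l (x - δ • y) = l x + -(δ * l y) := by
          rw [map_sub, map_smul, smul_eq_mul]; ring
        show Real.exp (l (x - δ • y)) * ρ y = Real.exp (l x) * (Real.exp (-(δ * l y)) * ρ y)
        rw [e, Real.exp_add]; ring
      rw [this]
      exact Submodule.smul_mem _ _ (Submodule.subset_span ⟨l, rfl⟩)
    | zero =>
      have : (Γ 0).comp (SM.ins δ) = 0 := by
        refine SM.ext fun x => ?_
        rw [SM.comp_apply, SM.ins_apply, hΓ]; simp
      rw [this]; exact Submodule.zero_mem _
    | add a b _ _ ha hb =>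
      have : (Γ (a + b)).comp (SM.ins δ) = (Γ a).comp (SM.ins δ) + (Γ b).comp (SM.ins δ) := by
        refine SM.ext fun x => ?_
        rw [SM.add_apply, SM.comp_apply, SM.comp_apply, SM.comp_apply, SM.ins_apply, hΓ, hΓ, hΓ,
          ← integral_add (hinteg _ _ _) (hinteg _ _ _)]
        simp only [SM.add_apply, add_mul]
      rw [this]; exact Submodule.add_mem _ ha hb
    | smul c a _ ha =>
      have : (Γ (c • a)).comp (SM.ins δ) = c • (Γ a).comp (SM.ins δ) := by
        refine SM.ext fun x => ?_
        rw [SM.smul_apply, SM.comp_apply, SM.comp_apply, SM.ins_apply, hΓ, hΓ, smul_eq_mul,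
          ← integral_const_mul]
        simp only [SM.smul_apply, smul_eq_mul, mul_assoc]
      rw [this]; exact Submodule.smul_mem _ _ ha
  have i3 : ∀ δ : ℝ, 0 < δ → ∀ g : SM F ℝ, ∀ R : ℝ, ∃ κ' : SM (F × F) ℝ,
      ∀ (a : SM F ℝ), ∀ x ∈ Metric.ball (0:F) R, (Γ a).comp (SM.ins δ) x =
        siop μ (isCompact_closedBall (0:F) (R + δ)) κ' (SM.toCM a) x := by
    intro δ hδ g R
    refine ⟨SM.mk (fun z => |(δ ^ Module.finrank ℝ F)⁻¹| * ρ (δ⁻¹ • (z.1 - z.2))) (by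
      have := ρ.smooth
      fun_prop), fun a x hx => ?_⟩
    rw [SM.comp_apply, SM.ins_apply, hΓ,
      setIntegral_eq_integral_of_forall_compl_eq_zero (fun y hy => by rw [hρ0 y hy, mul_zero])]
    have e1 : (fun y => a (x - δ • y) * ρ y) =
        fun y => (fun z => a (x - z) * ρ (δ⁻¹ • z)) (δ • y) := by
      funext y; simp only [smul_smul, inv_mul_cancel₀ hδ.ne', one_smul]
    have e2 := Measure.integral_comp_smul μ (fun z => a (x - z) * ρ (δ⁻¹ • z)) δ
    have e3 := integral_sub_left_eq_self (fun z => a (x - z) * ρ (δ⁻¹ • z)) μ x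
    rw [e1, e2, ← e3]
    simp only [sub_sub_cancel]
    show _ = ∫ y in Metric.closedBall (0:F) (R + δ), a y • (|(δ ^ Module.finrank ℝ F)⁻¹| * ρ (δ⁻¹ • (x - y))) ∂μ
    rw [setIntegral_eq_integral_of_forall_compl_eq_zero, smul_eq_mul, ← integral_const_mul]
    · congr 1; funext y; simp only [smul_eq_mul]; ring
    · intro y hy
      rw [hρ0, mul_zero, smul_zero]
      intro hmem
      apply hy
      rw [mem_closedBall_zero_iff, norm_smul, norm_inv, Real.norm_eq_abs, abs_of_pos hδ,
        inv_mul_le_iff₀ hδ, mul_one] at hmem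
      rw [mem_ball_zero_iff] at hx
      rw [mem_closedBall_zero_iff]
      have : ‖y‖ ≤ ‖x‖ + ‖x - y‖ := by
        have := norm_sub_le x (x - y); simpa using this
      linarith
  have i4 : ∀ δ : ℝ, 0 < δ → (Γ f).comp (SM.ins δ) ∈ closure (expSpan F : Set (SM F ℝ)) := by
    intro δ hδ
    obtain ⟨a, ha, hlim⟩ := exp_SW f
    have : Tendsto (fun n => (Γ (a n)).comp (SM.ins δ)) atTop (𝓝 ((Γ f).comp (SM.ins δ))) := by
      rw [tendsto_iff_TK]
      intro k
      refine TK_local k fun R => ?_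
      obtain ⟨κ', hκ'⟩ := i3 δ hδ f R
      exact ⟨_, _, siop_TK μ k (isCompact_closedBall (0:F) (R + δ)) κ' hlim,
        fun i x hx => hκ' (a i) x hx, fun x hx => hκ' f x hx⟩
    exact mem_closure_of_tendsto this (Eventually.of_forall fun n => i2 _ (ha n) δ)
  have lim : Tendsto (fun n : ℕ => (Γ f).comp (SM.ins (1 / (n + 1 : ℝ)))) atTop (𝓝 f) := by
    have := tendsto_param (E := F) tendsto_one_div_add_atTop_nhds_zero_nat (Γ f)
    rwa [i1] at this
  rw [← closure_closure]
  exact mem_closure_of_tendsto lim (Eventually.of_forall fun n => i4 _ (by positivity))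

end Density

end HamReach
end

end Part4

section Part5
open MeasureTheory Real

open Filter Topology
set_option linter.unusedSectionVars false

noncomputable section

namespace HamReach

section Cl
variable {E F : Type} [NormedAddCommGroup E] [NormedSpace ℝ E] [FiniteDimensional ℝ E]
  [NormedAddCommGroup F] [NormedSpace ℝ F] [FiniteDimensional ℝ F]

/-- The derivative as a smooth map. -/
def SM.D (f : SM E F) : SM E (E →L[ℝ] F) := SM.mk (fderiv ℝ f) (f.smooth.fderiv_right (by simp))

lemma tendsto_sum {ι κ : Type*} {l : Filter ι} (s : Finset κ) {f : κ → ι → SM E F} {f₀ : κ → SM E F}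
    (h : ∀ k ∈ s, Tendsto (f k) l (𝓝 (f₀ k))) :
    Tendsto (fun i => ∑ k ∈ s, f k i) l (𝓝 (∑ k ∈ s, f₀ k)) := by
  classical
  induction s using Finset.induction_on with
  | empty => simpa using tendsto_const_nhds
  | insert a s ha ih =>
    simp only [Finset.sum_insert ha]
    exact tendsto_add (h a (Finset.mem_insert_self _ _))
      (ih fun k hk => h k (Finset.mem_insert_of_mem hk))

lemma SM.sum_apply {κ : Type*} (s : Finset κ) (f : κ → SM E F) (x : E) :
    (∑ k ∈ s, f k) x = ∑ k ∈ s, f k x := by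
  classical
  induction s using Finset.induction_on with
  | empty => rfl
  | insert a s ha ih => rw [Finset.sum_insert ha, Finset.sum_insert ha, SM.add_apply, ih]

lemma SM.D_eq (f : SM E F) : SM.D f =
    ∑ k, (SM.ofCLM (((ContinuousLinearMap.smulRightL ℝ E F
      (LinearMap.toContinuousLinearMap ((Module.finBasis ℝ E).coord k)))).comp
        (ContinuousLinearMap.snd ℝ F F))).comp
      ((SM.T f).comp (SM.pair SM.id (SM.const (Module.finBasis ℝ E k)))) := by
  refine SM.ext fun x => ?_
  rw [SM.sum_apply]
  ext v
  rw [_root_.sum_apply]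
  have := (Module.finBasis ℝ E).sum_repr v
  conv_lhs => rw [← this, map_sum]
  refine Finset.sum_congr rfl fun k _ => ?_
  rw [map_smul]
  rfl

lemma tendsto_D {ι : Type*} {l : Filter ι} {f : ι → SM E F} {f₀ : SM E F}
    (hf : Tendsto f l (𝓝 f₀)) : Tendsto (fun i => SM.D (f i)) l (𝓝 (SM.D f₀)) := by
  simp only [SM.D_eq]
  exact tendsto_sum _ fun k _ => tendsto_comp tendsto_const_nhds
    (tendsto_comp (tendsto_T hf) tendsto_const_nhds)

end Cl

lemma eventually_iter {ι : Type*} {l : Filter ι} {E : Type} [NormedAddCommGroup E]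
    [NormedSpace ℝ E] [FiniteDimensional ℝ E] (j : ℕ) {K : Set E} (hK : IsCompact K) {ε : ℝ}
    (hε : 0 < ε) :
    ∀ {F : Type} [NormedAddCommGroup F] [NormedSpace ℝ F] [FiniteDimensional ℝ F]
    {f : ι → SM E F}, Tendsto f l (𝓝 0) →
    ∀ᶠ i in l, ∀ x ∈ K, ‖iteratedFDeriv ℝ j (f i) x‖ < ε := by
  induction j with
  | zero =>
    intro F _ _ _ f hf
    have h := tendsto_toCM hf
    rw [ContinuousMap.tendsto_iff_forall_isCompact_tendstoUniformlyOn] at h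
    have h := (Metric.tendstoUniformlyOn_iff.1 (h K hK)) ε hε
    filter_upwards [h] with i hi x hx
    have := hi x hx
    rw [norm_iteratedFDeriv_zero]
    simpa using this
  | succ j ih =>
    intro F _ _ _ f hf
    have h := tendsto_D hf
    have e : SM.D (0 : SM E F) = 0 := by
      refine SM.ext fun x => ?_
      show fderiv ℝ (fun _ => (0:F)) x = 0
      simp
    rw [e] at h
    filter_upwards [ih h] with i hi x hx
    rw [← norm_iteratedFDeriv_fderiv]
    exact hi x hx

section Reach
variable {d : ℕ} {U : Type} (Ham : U → Phase d → ℝ)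

/-- Maps reachable within time `τ`. -/
def RA (τ : ℝ) : Set (SM (Phase d) (Phase d)) := {Φ | ∃ t, 0 ≤ t ∧ t ≤ τ ∧ Reachable Ham t Φ}

/-- Maps approximately reachable within time `τ`. -/
def RB (τ : ℝ) : Set (SM (Phase d) (Phase d)) := closure (RA Ham τ)

/-- Maps approximately reachable in small time. -/
def RS : Set (SM (Phase d) (Phase d)) := {Φ | ∀ τ > 0, Φ ∈ RB Ham τ}

variable {Ham}

lemma foldl_comp {α : Type*} (L : List (α → α)) (g : α → α) :
    L.foldl (fun g f => f ∘ g) g = L.foldl (fun g f => f ∘ g) id ∘ g := by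
  induction L generalizing g with
  | nil => rfl
  | cons a L ih =>
    rw [List.foldl_cons, ih, List.foldl_cons, ih (a ∘ id)]; rfl

lemma reachable_comp {a b : ℝ} {Φ Ψ : Phase d → Phase d} (h1 : Reachable Ham a Φ)
    (h2 : Reachable Ham b Ψ) : Reachable Ham (b + a) (Φ ∘ Ψ) := by
  obtain ⟨n, s, u, φ, hs, hsum, hφ, rfl⟩ := h1
  obtain ⟨m, s', u', φ', hs', hsum', hφ', rfl⟩ := h2
  refine ⟨m + n, Fin.append s' s, Fin.append u' u, Fin.append φ' φ, ?_, ?_, ?_, ?_⟩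
  · intro i
    refine Fin.addCases (fun i => ?_) (fun i => ?_) i
    · simpa using hs' i
    · simpa using hs i
  · rw [Fin.sum_univ_add]; simp [hsum, hsum']
  · intro i
    refine Fin.addCases (fun i => ?_) (fun i => ?_) i
    · simpa using hφ' i
    · simpa using hφ i
  · have : (fun i => Fin.append φ' φ i (Fin.append s' s i)) =
        Fin.append (fun i => φ' i (s' i)) (fun i => φ i (s i)) := by
      funext i
      refine Fin.addCases (fun i => ?_) (fun i => ?_) i <;> simp
    rw [this, List.ofFn_fin_append, List.foldl_append]; exact (foldl_comp _ _).symm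

lemma reachable_zero : Reachable Ham 0 id :=
  ⟨0, fun i => i.elim0, fun i => i.elim0, fun i => i.elim0, fun i => i.elim0, by simp,
    fun i => i.elim0, by simp⟩

lemma reachable_flow {u : U} {φ : ℝ → Phase d → Phase d} (h : IsFlowOf (hamVF (Ham u)) φ) {t : ℝ}
    (ht : 0 ≤ t) : Reachable Ham t (φ t) :=
  ⟨1, fun _ => t, fun _ => u, fun _ => φ, fun _ => ht, by simp, fun _ => h, by simp⟩

lemma RA_mono {a b : ℝ} (h : a ≤ b) : RA Ham a ⊆ RA Ham b := by
  rintro Φ ⟨t, h0, h1, h2⟩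
  exact ⟨t, h0, h1.trans h, h2⟩

lemma RB_mono {a b : ℝ} (h : a ≤ b) : RB Ham a ⊆ RB Ham b := closure_mono (RA_mono h)

lemma RB_comp {a b : ℝ} {Φ Ψ : SM (Phase d) (Phase d)} (h1 : Φ ∈ RB Ham a) (h2 : Ψ ∈ RB Ham b) :
    Φ.comp Ψ ∈ RB Ham (a + b) := by
  refine map_mem_closure₂ (f := fun Φ Ψ => SM.comp Φ Ψ) continuous_comp h1 h2 ?_
  rintro Φ ⟨t, ht, hta, hr⟩ Ψ ⟨s, hs, hsb, hr'⟩
  exact ⟨s + t, add_nonneg hs ht, by linarith,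
    show Reachable Ham (s + t) (Φ.fn ∘ Ψ.fn) from reachable_comp hr hr'⟩

lemma RS_sub {a : ℝ} (ha : 0 < a) {Φ : SM (Phase d) (Phase d)} (h : Φ ∈ RS Ham) : Φ ∈ RB Ham a :=
  h a ha

lemma RS_id : SM.id ∈ RS Ham := fun τ hτ => subset_closure ⟨0, le_rfl, hτ.le, reachable_zero⟩

lemma RS_comp {Φ Ψ : SM (Phase d) (Phase d)} (h1 : Φ ∈ RS Ham) (h2 : Ψ ∈ RS Ham) :
    Φ.comp Ψ ∈ RS Ham := by
  intro τ hτ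
  have := RB_comp (h1 (τ/2) (half_pos hτ)) (h2 (τ/2) (half_pos hτ))
  rwa [add_halves] at this

lemma RB_RS {a : ℝ} {Φ : SM (Phase d) (Phase d)} (h : ∀ τ > 0, Φ ∈ RB Ham (a * τ)) (ha : 0 < a):
    Φ ∈ RS Ham := by
  intro τ hτ
  have := h (τ / a) (by positivity)
  rwa [mul_div_cancel₀ _ ha.ne'] at this

lemma RB_closed (a : ℝ) : IsClosed (RB Ham a) := isClosed_closure

lemma RS_closed : IsClosed (RS Ham) := by
  have : RS Ham = ⋂ τ > 0, RB Ham τ := by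
    ext Φ; simp [RS]
  rw [this]
  exact isClosed_biInter fun τ _ => RB_closed τ

lemma RS_of_tendsto {ι : Type*} {l : Filter ι} [l.NeBot] {Φ : ι → SM (Phase d) (Phase d)}
    {Ψ : SM (Phase d) (Phase d)} (h : Tendsto Φ l (𝓝 Ψ)) {τ : ι → ℝ} (hτ : Tendsto τ l (𝓝 0))
    (hm : ∀ᶠ i in l, Φ i ∈ RB Ham (τ i)) : Ψ ∈ RS Ham := by
  intro a ha
  refine (RB_closed a).mem_of_tendsto h ?_
  filter_upwards [hm, hτ.eventually (gt_mem_nhds ha)] with i hi1 hi2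
  exact RB_mono hi2.le hi1

theorem smallTime_of_RS {Ψ : SM (Phase d) (Phase d)} (h : Ψ ∈ RS Ham) :
    SmallTimeReachable Ham Ψ := by
  intro ε hε K hK ℓ
  have h1 := h ε hε
  have : (𝓝[RA Ham ε] Ψ).NeBot := mem_closure_iff_nhdsWithin_neBot.1 h1
  have ht : Tendsto (fun Φ => Φ - Ψ) (𝓝[RA Ham ε] Ψ) (𝓝 0) := by
    have := tendsto_sub (tendsto_id.mono_left (nhdsWithin_le_nhds (a := Ψ) (s := RA Ham ε)))
      (tendsto_const_nhds (x := Ψ))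
    simpa using this
  have h2 : ∀ᶠ Φ in 𝓝[RA Ham ε] Ψ, ∀ j ∈ Set.Iic ℓ, ∀ x ∈ K,
      ‖iteratedFDeriv ℝ j (Φ - Ψ : SM (Phase d) (Phase d)) x‖ < ε :=
    (Set.finite_Iic ℓ).eventually_all.2 fun j _ => eventually_iter j hK hε ht
  obtain ⟨Φ, hΦ, t, ht0, ht1, hr⟩ := (h2.and self_mem_nhdsWithin).exists
  exact ⟨t, ⟨ht0, ht1⟩, Φ, hr, fun j hj x hx => hΦ j hj x hx⟩

end Reach

end HamReach
end

end Part5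

section Part6
open MeasureTheory Real

open Filter Topology

noncomputable section

namespace HamReach

section Family
variable {E : Type} [NormedAddCommGroup E] [NormedSpace ℝ E] [FiniteDimensional ℝ E]

/-- Solutions of a smooth family of differential equations depend smoothly on everything. -/
lemma family (Z : SM (ℝ × E) E) (ψ : ℝ → E → E)
    (h : ∀ σ x, ∃ γ : ℝ → E, γ 0 = x ∧ (∀ t, HasDerivAt γ (Z (σ, γ t)) t) ∧ γ 1 = ψ σ x) :
    ∃ Ψ : SM (ℝ × E) E, ∀ σ x, Ψ (σ, x) = ψ σ x := by
  have hs : Sol (SM.pair (SM.const (0:ℝ)) Z) (SM.id : SM (ℝ × E) (ℝ × E))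
      (fun z => (z.1, ψ z.1 z.2)) := by
    rintro ⟨σ, x⟩
    obtain ⟨γ, h0, h1, h2⟩ := h σ x
    refine ⟨fun t => (σ, γ t), by simp [h0], fun t _ => ?_, by simp [h2]⟩
    exact ((hasDerivAt_const t σ).prodMk (h1 t)).hasDerivWithinAt
  exact ⟨SM.mk (fun z => ψ z.1 z.2) hs.smooth.snd, fun σ x => rfl⟩

lemma smooth_flow (X : SM E E) (K : NNReal) (hK : LipschitzWith K X) :
    ∃ φ : SM (ℝ × E) E, (∀ x, φ (0, x) = x) ∧
      ∀ x t, HasDerivAt (fun s => φ (s, x)) (X (φ (t, x))) t := by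
  obtain ⟨φ, h0, h1⟩ := global_flow X K hK
  obtain ⟨Ψ, hΨ⟩ := family (SM.mk (fun z : ℝ × E => z.1 • X z.2) (by
      have := X.smooth
      fun_prop)) φ (fun σ x => by
    refine ⟨fun t => φ (σ * t) x, by simp [h0], fun t => ?_, by simp⟩
    have a : HasDerivAt (fun t : ℝ => σ * t) σ t := by
      simpa using (hasDerivAt_id t).const_mul σ
    exact (h1 x (σ * t)).scomp t a)
  refine ⟨Ψ, fun x => by rw [hΨ, h0], fun x t => ?_⟩
  simp only [hΨ]
  exact h1 x t

/-- First order consistency of a flow. -/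
lemma flow_consistency (X : SM E E) (φ : SM (ℝ × E) E) (h0 : ∀ x, φ (0, x) = x)
    (h1 : ∀ x t, HasDerivAt (fun s => φ (s, x)) (X (φ (t, x))) t) {ι : Type*} {l : Filter ι}
    {c : ι → ℝ} (hc : Tendsto c l (𝓝 0)) (hc0 : ∀ i, c i ≠ 0) :
    Tendsto (fun i => (c i)⁻¹ • (φ.comp (SM.ins (c i)) - SM.id)) l (𝓝 X) := by
  obtain ⟨Ψ, hΨ⟩ := family (E := E × E)
    (SM.mk (fun z : ℝ × (E × E) => ((0 : E), X (z.2.1 + z.1 • z.2.2))) (by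
      have := X.smooth
      fun_prop))
    (fun σ z => if σ = 0 then (z.1, z.2 + X z.1)
      else (z.1, σ⁻¹ • (φ (σ, z.1 + σ • z.2) - z.1))) (fun σ z => by
    by_cases hσ : σ = 0
    · subst hσ
      refine ⟨fun t => (z.1, z.2 + t • X z.1), by simp, fun t => ?_, by simp⟩
      have a : HasDerivAt (fun t : ℝ => z.2 + t • X z.1) (X z.1) t := by
        simpa using ((hasDerivAt_id t).smul_const (X z.1)).const_add z.2
      simpa using (hasDerivAt_const t z.1).prodMk a
    · refine ⟨fun t => (z.1, σ⁻¹ • (φ (σ * t, z.1 + σ • z.2) - z.1)), ?_, fun t => ?_, ?_⟩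
      · simp [h0, hσ, smul_smul]
      · have a : HasDerivAt (fun t : ℝ => σ * t) σ t := by
          simpa using (hasDerivAt_id t).const_mul σ
        have b := (((h1 (z.1 + σ • z.2) (σ * t)).scomp t a).sub_const z.1).const_smul σ⁻¹
        have := (hasDerivAt_const t z.1).prodMk b
        simpa [smul_smul, hσ] using this
      · simp [hσ])
  have key := tendsto_comp (tendsto_param hc Ψ)
    (tendsto_const_nhds (x := SM.pair (SM.id : SM E E) (SM.const (0 : E))))
  have key2 := tendsto_comp (tendsto_const_nhds (x := SM.ofCLM (ContinuousLinearMap.snd ℝ E E))) key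
  refine (key2.congr fun i => ?_).trans (le_of_eq ?_)
  · refine SM.ext fun x => ?_
    simp [hΨ, hc0 i]
  · congr 1
    refine SM.ext fun x => ?_
    simp [hΨ]

end Family

section Shear
variable {d : ℕ}

/-- Evaluation of a functional at the standard basis. -/
def evA (d : ℕ) : ((Fin d → ℝ) →L[ℝ] ℝ) →L[ℝ] (Fin d → ℝ) :=
  ContinuousLinearMap.pi fun i => ContinuousLinearMap.apply ℝ ℝ (Pi.single i 1)

/-- The gradient. -/
def grad (f : SM (Fin d → ℝ) ℝ) : SM (Fin d → ℝ) (Fin d → ℝ) := (SM.ofCLM (evA d)).comp (SM.D f)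

lemma grad_apply (f : SM (Fin d → ℝ) ℝ) (q : Fin d → ℝ) (i : Fin d) :
    grad f q i = fderiv ℝ f q (Pi.single i 1) := rfl

lemma grad_of_hasFDerivAt {f : SM (Fin d → ℝ) ℝ} {q : Fin d → ℝ} {L : (Fin d → ℝ) →L[ℝ] ℝ}
    (h : HasFDerivAt f L q) (i : Fin d) : grad f q i = L (Pi.single i 1) := by
  rw [grad_apply, h.fderiv]

lemma tendsto_grad {ι : Type*} {l : Filter ι} {f : ι → SM (Fin d → ℝ) ℝ} {f₀ : SM (Fin d → ℝ) ℝ}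
    (hf : Tendsto f l (𝓝 f₀)) : Tendsto (fun i => grad (f i)) l (𝓝 (grad f₀)) :=
  tendsto_comp tendsto_const_nhds (tendsto_D hf)

lemma grad_add (f h : SM (Fin d → ℝ) ℝ) : grad (f + h) = grad f + grad h := by
  refine SM.ext fun q => funext fun i => ?_
  have : fderiv ℝ (f + h : SM _ ℝ) q = fderiv ℝ f q + fderiv ℝ h q :=
    fderiv_add (f.differentiable _) (h.differentiable _)
  rw [SM.add_apply, Pi.add_apply, grad_apply, grad_apply, grad_apply, this]; rfl

lemma grad_smul (c : ℝ) (f : SM (Fin d → ℝ) ℝ) : grad (c • f) = c • grad f := by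
  refine SM.ext fun q => funext fun i => ?_
  have : fderiv ℝ (c • f : SM _ ℝ) q = c • fderiv ℝ f q :=
    fderiv_const_smul (f.differentiable _) c
  rw [SM.smul_apply, Pi.smul_apply, grad_apply, grad_apply, this]; rfl

/-- The vertical shear as a smooth map. -/
def V (f : SM (Fin d → ℝ) ℝ) : SM (Phase d) (Phase d) :=
  SM.id - SM.pair (SM.const 0) ((grad f).comp (SM.ofCLM (ContinuousLinearMap.fst ℝ _ _)))

lemma V_apply (f : SM (Fin d → ℝ) ℝ) (x : Phase d) : V f x = (x.1, x.2 - grad f x.1) := by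
  simp [V, Prod.ext_iff]

lemma tendsto_V {ι : Type*} {l : Filter ι} {f : ι → SM (Fin d → ℝ) ℝ} {f₀ : SM (Fin d → ℝ) ℝ}
    (hf : Tendsto f l (𝓝 f₀)) : Tendsto (fun i => V (f i)) l (𝓝 (V f₀)) :=
  tendsto_sub tendsto_const_nhds (tendsto_pair tendsto_const_nhds
    (tendsto_comp (tendsto_grad hf) tendsto_const_nhds))

lemma V_add (f h : SM (Fin d → ℝ) ℝ) : V (f + h) = (V f).comp (V h) := by
  refine SM.ext fun x => ?_
  rw [SM.comp_apply, V_apply, V_apply, V_apply, grad_add]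
  simp only [SM.add_apply, Prod.mk.injEq, true_and]
  abel

/-- The mechanical vector field `(p, -∇f)`. -/
def Yf (f : SM (Fin d → ℝ) ℝ) : SM (Phase d) (Phase d) :=
  SM.pair (SM.ofCLM (ContinuousLinearMap.snd ℝ _ _))
    (-((grad f).comp (SM.ofCLM (ContinuousLinearMap.fst ℝ _ _))))

lemma Yf_apply (f : SM (Fin d → ℝ) ℝ) (x : Phase d) : Yf f x = (x.2, - grad f x.1) := rfl

lemma Yf_lip {f : SM (Fin d → ℝ) ℝ} {L : NNReal} (h : LipschitzWith L (grad f)) :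
    ∃ K, LipschitzWith K (Yf f) :=
  ⟨_, LipschitzWith.prodMk LipschitzWith.prod_snd (h.comp LipschitzWith.prod_fst).neg⟩

/-- Coordinates. -/
def prj (i : Fin d) : (Fin d → ℝ) →L[ℝ] ℝ := ContinuousLinearMap.proj i

@[simp] lemma prj_apply (i : Fin d) (q : Fin d → ℝ) : prj i q = q i := rfl

/-- The linear functional with coefficients `a`. -/
def dotL (a : Fin d → ℝ) : (Fin d → ℝ) →L[ℝ] ℝ := ∑ i, a i • prj i

lemma dotL_apply (a q : Fin d → ℝ) : dotL a q = ∑ i, a i * q i := by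
  simp [dotL]

lemma dotL_single (a : Fin d → ℝ) (i : Fin d) : dotL a (Pi.single i 1) = a i := by
  simp [dotL_apply, Pi.single_apply]

lemma dotL_comm (a b : Fin d → ℝ) : dotL a b = dotL b a := by
  simp [dotL_apply, mul_comm]

lemma dotL_repr (l : (Fin d → ℝ) →L[ℝ] ℝ) : ∃ a, l = dotL a := by
  refine ⟨evA d l, ?_⟩
  ext q
  have : q = ∑ i, q i • Pi.single i (1:ℝ) := by
    ext j; simp [Finset.sum_apply, Pi.single_apply]
  conv_lhs => rw [this, map_sum]
  rw [dotL_apply]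
  refine Finset.sum_congr rfl fun i _ => ?_
  rw [map_smul, smul_eq_mul, mul_comm]; rfl

lemma grad_dotL (a q : Fin d → ℝ) : grad (SM.ofCLM (dotL a)) q = a := by
  funext i
  have h : HasFDerivAt (SM.ofCLM (dotL a)) (dotL a) q := (dotL a).hasFDerivAt
  rw [grad_of_hasFDerivAt h, dotL_single]

/-- The Gaussian. -/
def gs (d : ℕ) : SM (Fin d → ℝ) ℝ := SM.mk (fun q => Real.exp (-(∑ i, (q i) ^ 2) / 2)) (by fun_prop)

lemma gs_hasFDerivAt (q : Fin d → ℝ) : HasFDerivAt (gs d) (-(gs d q) • dotL q) q := by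
  have h1 : ∀ i : Fin d, HasFDerivAt (fun q : Fin d → ℝ => (q i) ^ 2)
      ((2 * q i) • prj i) q := by
    intro i
    have := ((prj i).hasFDerivAt (x := q)).pow 2
    simpa using this
  have h2 := HasFDerivAt.fun_sum (u := Finset.univ) fun i _ => h1 i
  have h3 := ((h2.neg.mul_const (1/2)).exp)
  have e : (fun q : Fin d → ℝ => Real.exp (-(∑ i, (q i) ^ 2) * (1/2))) = gs d := by
    funext q; simp only [gs, SM.mk_apply]; congr 1; ring
  simp only [Pi.neg_apply] at h3
  rw [e] at h3
  have e2 : Real.exp (-(∑ i, (q i) ^ 2) * (1/2)) = gs d q := congrFun e q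
  rw [e2] at h3
  refine h3.congr_fderiv ?_
  ext v
  simp [dotL_apply, Finset.mul_sum, mul_assoc]

lemma grad_gs (q : Fin d → ℝ) (i : Fin d) : grad (gs d) q i = -(gs d q) * q i := by
  rw [grad_of_hasFDerivAt (gs_hasFDerivAt q)]
  simp [dotL_single]

lemma gs_bound (q : Fin d → ℝ) : (∑ i, (q i)^2) * gs d q ≤ 2 := by
  have h := Real.add_one_le_exp ((∑ i, (q i)^2)/2)
  have h2 : gs d q * Real.exp ((∑ i, (q i)^2)/2) = 1 := by
    show Real.exp _ * _ = _
    rw [← Real.exp_add, Real.exp_eq_one_iff]; ring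
  have h3 : 0 < gs d q := Real.exp_pos _
  nlinarith

lemma gs_le_one (q : Fin d → ℝ) : gs d q ≤ 1 := by
  show Real.exp _ ≤ 1
  rw [Real.exp_le_one_iff]
  have : 0 ≤ ∑ i, (q i)^2 := Finset.sum_nonneg fun i _ => sq_nonneg _
  linarith

lemma gs_lip : ∃ L, LipschitzWith L (grad (gs d)) := by
  refine ⟨(1 + 2 * d : ℝ).toNNReal, ?_⟩
  have hC : (0:ℝ) ≤ 1 + 2 * d := by positivity
  have hcomp : ∀ i, LipschitzWith (1 + 2 * d : ℝ).toNNReal (fun q => grad (gs d) q i) := by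
    intro i
    have hd : ∀ q, HasFDerivAt (fun q => grad (gs d) q i)
        ((-(gs d q)) • prj i + q i • ((gs d q) • dotL q)) q := by
      intro q
      have := ((gs_hasFDerivAt q).neg).mul
        ((prj i).hasFDerivAt (x := q))
      simp only [grad_gs]
      have e : (-(gs d q)) • prj i + q i • ((gs d q) • dotL q) =
        (-(gs d).fn) q • prj i + (prj i) q • -(-(gs d).fn q • dotL q) := by
        ext v; simp
      rw [e]
      exact this
    refine lipschitzWith_of_nnnorm_fderiv_le (𝕜 := ℝ) (fun q => (hd q).differentiableAt) fun q => ?_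
    rw [(hd q).fderiv, ← NNReal.coe_le_coe, Real.coe_toNNReal _ hC, coe_nnnorm]
    refine ContinuousLinearMap.opNorm_le_bound _ hC fun v => ?_
    have hv : ∀ j, |v j| ≤ ‖v‖ := fun j => norm_le_pi_norm v j
    have g0 : 0 < gs d q := Real.exp_pos _
    have g1 := gs_le_one q
    have hq : ∀ j, |q i * q j| ≤ ∑ i, (q i)^2 := by
      intro j
      have a1 : (q i)^2 ≤ ∑ i, (q i)^2 :=
        Finset.single_le_sum (f := fun i => (q i)^2) (fun i _ => sq_nonneg _) (Finset.mem_univ i)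
      have a2 : (q j)^2 ≤ ∑ i, (q i)^2 :=
        Finset.single_le_sum (f := fun i => (q i)^2) (fun i _ => sq_nonneg _) (Finset.mem_univ j)
      rw [abs_le]; constructor <;> nlinarith [sq_nonneg (q i - q j), sq_nonneg (q i + q j)]
    have e : ((-(gs d q)) • prj i
        + q i • ((gs d q) • dotL q)) v = -(gs d q * v i) + ∑ j, (q i * q j) * gs d q * v j := by
      simp [dotL_apply, Finset.mul_sum]
      refine Finset.sum_congr rfl fun j _ => ?_
      ring
    rw [e, Real.norm_eq_abs]
    have b1 : |-(gs d q * v i)| ≤ ‖v‖ := by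
      rw [abs_neg, abs_mul, abs_of_pos g0]
      nlinarith [hv i, abs_nonneg (v i)]
    have b2 : |∑ j, (q i * q j) * gs d q * v j| ≤ ∑ j : Fin d, 2 * ‖v‖ := by
      refine (Finset.abs_sum_le_sum_abs _ _).trans (Finset.sum_le_sum fun j _ => ?_)
      rw [abs_mul, abs_mul, abs_of_pos g0]
      have : |q i * q j| * gs d q ≤ 2 :=
        (mul_le_mul_of_nonneg_right (hq j) g0.le).trans (gs_bound q)
      exact mul_le_mul this (hv j) (abs_nonneg _) (by norm_num)
    simp at b2
    refine (abs_add_le _ _).trans ?_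
    nlinarith
  refine LipschitzWith.of_dist_le_mul fun x y => ?_
  rw [dist_pi_le_iff (by positivity)]
  exact fun i => (hcomp i).dist_le_mul x y

/-- The control potentials. -/
def hc (u : (Fin d → ℝ) × ℝ) : SM (Fin d → ℝ) ℝ := SM.ofCLM (dotL u.1) + u.2 • gs d

lemma hc_smul (c : ℝ) (u : (Fin d → ℝ) × ℝ) : hc (c • u) = c • hc u := by
  refine SM.ext fun q => ?_
  simp [hc, dotL_apply, Finset.mul_sum, mul_assoc]

lemma hc_lip (u : (Fin d → ℝ) × ℝ) : ∃ L, LipschitzWith L (grad (hc u)) := by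
  obtain ⟨L, hL⟩ := gs_lip (d := d)
  have : (grad (hc u) : (Fin d → ℝ) → (Fin d → ℝ)) = fun q => u.1 + u.2 • grad (gs d) q := by
    funext q
    rw [hc, grad_add, grad_smul, SM.add_apply, grad_dotL]; rfl
  rw [this]
  exact ⟨_, (LipschitzWith.const u.1).add ((lipschitzWith_smul u.2).comp hL)⟩

lemma hamVF_euc (f : SM (Fin d → ℝ) ℝ) (u : (Fin d → ℝ) × ℝ) (x : Phase d) :
    hamVF (eucHam f u) x = Yf (f + hc u) x := by
  have h1 : ∀ i : Fin d, HasFDerivAt (fun x : Phase d => (x.2 i) ^ 2)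
      ((2 * x.2 i) • (prj i).comp (ContinuousLinearMap.snd ℝ (Fin d → ℝ) (Fin d → ℝ))) x := by
    intro i
    have := (((prj i).comp
      (ContinuousLinearMap.snd ℝ (Fin d → ℝ) (Fin d → ℝ))).hasFDerivAt (x := x)).pow 2
    simpa using this
  have h2 := (HasFDerivAt.fun_sum (u := Finset.univ) fun i _ => h1 i).mul_const (1/2)
  have h3 := (((f + hc u).differentiable x.1).hasFDerivAt).comp x (hasFDerivAt_fst (p := x) (𝕜 := ℝ))
  have h4 := h2.add h3
  have e : eucHam f u = fun x : Phase d => (∑ i, (x.2 i) ^ 2) * (1/2) + (f + hc u : SM _ ℝ) x.1 := by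
    funext x
    simp [eucHam, hc, dotL_apply, gs]; ring
  have e' : eucHam f u = (fun y : Phase d => (∑ i, y.2 i ^ 2) * (1 / 2)) + (f + hc u).fn ∘ Prod.fst := e
  have h5 := h4.fderiv
  rw [← e'] at h5
  rw [Yf_apply]
  refine Prod.ext (funext fun i => ?_) (funext fun i => ?_)
  · simp only [hamVF, h5]
    simp [Pi.single_apply]
  · simp only [hamVF, h5]
    simp [grad_apply]

end Shear

end HamReach
end

end Part6

section Part7
open MeasureTheory Real

open Filter Topology

noncomputable section

namespace HamReach

section Dyn
variable {d : ℕ} {W : SM (Fin d → ℝ) ℝ}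

lemma lip_grad (hL : ∃ L : NNReal, LipschitzWith L (fderiv ℝ W)) : ∃ L, LipschitzWith L (grad W) := by
  obtain ⟨L, hL⟩ := hL
  exact ⟨_, (evA d).lipschitz.comp hL⟩

lemma lip_add {f h : SM (Fin d → ℝ) ℝ} (hf : ∃ L, LipschitzWith L (grad f))
    (hh : ∃ L, LipschitzWith L (grad h)) : ∃ L, LipschitzWith L (grad (f + h)) := by
  obtain ⟨L, hL⟩ := hf
  obtain ⟨M, hM⟩ := hh
  rw [grad_add]
  exact ⟨_, hL.add hM⟩

/-- The controlled flows, jointly smooth in time and space. -/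
lemma ctl_flow (hL : ∃ L, LipschitzWith L (grad W)) (u : (Fin d → ℝ) × ℝ) :
    ∃ φ : SM (ℝ × Phase d) (Phase d), (∀ x, φ (0, x) = x) ∧
      (∀ x t, HasDerivAt (fun s => φ (s, x)) (Yf (W + hc u) (φ (t, x))) t) ∧
      ∀ t, 0 ≤ t → φ.comp (SM.ins t) ∈ RB (eucHam W) t := by
  obtain ⟨L, hL'⟩ := lip_add hL (hc_lip u)
  obtain ⟨K, hK⟩ := Yf_lip hL'
  obtain ⟨φ, h0, h1⟩ := smooth_flow _ K hK
  refine ⟨φ, h0, h1, fun t ht => subset_closure ⟨t, ht, le_rfl, ?_⟩⟩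
  have : IsFlowOf (hamVF (eucHam W u)) (fun t x => φ (t, x)) := by
    refine ⟨h0, fun x t => ?_⟩
    rw [hamVF_euc]
    exact h1 x t
  exact reachable_flow this ht

lemma tendsto_inv_succ : Tendsto (fun n : ℕ => ((n : ℝ) + 1)⁻¹) atTop (𝓝 0) := by
  simpa using tendsto_one_div_add_atTop_nhds_zero_nat (𝕜 := ℝ)

lemma hasDerivAt_mul_left (σ t : ℝ) : HasDerivAt (fun t : ℝ => σ * t) σ t := by
  simpa using (hasDerivAt_id t).const_mul σ

/-- Step 1: shears of control potentials. -/
lemma V_hc (hL : ∃ L, LipschitzWith L (grad W)) (u : (Fin d → ℝ) × ℝ) :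
    V (hc u) ∈ RS (eucHam W) := by
  choose φ h0 h1 h2 using ctl_flow hL
  obtain ⟨Ψ, hΨ⟩ := family (E := Phase d)
    (SM.mk (fun z : ℝ × Phase d => (z.1 • z.2.2, -(z.1 • grad W z.2.1) - grad (hc u) z.2.1)) (by
      have := (grad W).smooth
      have := (grad (hc u)).smooth
      fun_prop))
    (fun σ x => if σ = 0 then V (hc u) x else φ (σ⁻¹ • u) (σ, x)) (fun σ x => by
    by_cases hσ : σ = 0
    · subst hσ
      refine ⟨fun t => (x.1, x.2 + t • (- grad (hc u) x.1)), by simp, fun t => ?_,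
        by simp [V_apply, sub_eq_add_neg]⟩
      have a : HasDerivAt (fun t : ℝ => x.2 + t • (-grad (hc u) x.1)) (-grad (hc u) x.1) t := by
        simpa using ((hasDerivAt_id t).smul_const (-grad (hc u) x.1)).const_add x.2
      simpa using (hasDerivAt_const t x.1).prodMk a
    · refine ⟨fun t => φ (σ⁻¹ • u) (σ * t, x), by simp [h0], fun t => ?_, by simp [hσ]⟩
      have b := (h1 (σ⁻¹ • u) x (σ * t)).scomp t (hasDerivAt_mul_left σ t)
      rw [Yf_apply, hc_smul, grad_add, grad_smul] at b
      refine b.congr_deriv ?_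
      simp [smul_smul, hσ, sub_eq_add_neg]
      rw [add_comm])
  have lim := tendsto_param (E := Phase d) tendsto_inv_succ Ψ
  have e : Ψ.comp (SM.ins 0) = V (hc u) := SM.ext fun x => by simp [hΨ]
  rw [e] at lim
  refine RS_of_tendsto lim tendsto_inv_succ (Eventually.of_forall fun n => ?_)
  have hn : ((n : ℝ) + 1)⁻¹ ≠ 0 := by positivity
  have e2 : Ψ.comp (SM.ins ((n : ℝ) + 1)⁻¹) =
      (φ ((((n : ℝ) + 1)⁻¹)⁻¹ • u)).comp (SM.ins ((n : ℝ) + 1)⁻¹) :=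
    SM.ext fun x => by simp only [SM.comp_apply, SM.ins_apply, hΨ, if_neg hn]
  rw [e2]
  exact h2 _ _ (by positivity)

lemma V_dotL (hL : ∃ L, LipschitzWith L (grad W)) (a : Fin d → ℝ) :
    V (SM.ofCLM (dotL a)) ∈ RS (eucHam W) := by
  have := V_hc hL (a, 0)
  simpa [hc] using this

lemma V_dotL_apply (a : Fin d → ℝ) (x : Phase d) : V (SM.ofCLM (dotL a)) x = (x.1, x.2 - a) := by
  rw [V_apply, grad_dotL]

/-- Translations in position. -/
def Tr (a : Fin d → ℝ) : SM (Phase d) (Phase d) := SM.mk (fun x => (x.1 + a, x.2)) (by fun_prop)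

/-- Step 2: translations. -/
lemma Tr_mem (hL : ∃ L, LipschitzWith L (grad W)) (a : Fin d → ℝ) : Tr a ∈ RS (eucHam W) := by
  obtain ⟨φ, h0, h1, h2⟩ := ctl_flow hL 0
  have hc0 : hc (0 : (Fin d → ℝ) × ℝ) = 0 := by
    have := hc_smul (d := d) 0 0; simpa using this
  rw [hc0, add_zero] at h1
  obtain ⟨Ψ, hΨ⟩ := family (E := Phase d)
    (SM.mk (fun z : ℝ × Phase d => (z.1 • z.2.2 + a, -(z.1 • grad W z.2.1))) (by
      have := (grad W).smooth
      fun_prop))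
    (fun σ x => if σ = 0 then Tr a x else φ (σ, (x.1, x.2 + σ⁻¹ • a)) - (0, σ⁻¹ • a)) (fun σ x => by
    by_cases hσ : σ = 0
    · subst hσ
      refine ⟨fun t => (x.1 + t • a, x.2), by simp, fun t => ?_, by simp [Tr]⟩
      have b : HasDerivAt (fun t : ℝ => x.1 + t • a) a t := by
        simpa using ((hasDerivAt_id t).smul_const a).const_add x.1
      simpa using b.prodMk (hasDerivAt_const t x.2)
    · refine ⟨fun t => φ (σ * t, (x.1, x.2 + σ⁻¹ • a)) - (0, σ⁻¹ • a), by simp [h0], fun t => ?_,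
        by simp [hσ]⟩
      have b := ((h1 (x.1, x.2 + σ⁻¹ • a) (σ * t)).scomp t (hasDerivAt_mul_left σ t)).sub_const
        (0, σ⁻¹ • a)
      rw [Yf_apply] at b
      refine b.congr_deriv ?_
      simp [smul_smul, smul_sub, hσ])
  have lim := tendsto_param (E := Phase d) tendsto_inv_succ Ψ
  have e : Ψ.comp (SM.ins 0) = Tr a := SM.ext fun x => by simp [hΨ]
  rw [e] at lim
  have h3 : Tendsto (fun n : ℕ => 3 * ((n : ℝ) + 1)⁻¹) atTop (𝓝 0) := by
    simpa using tendsto_inv_succ.const_mul 3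
  refine RS_of_tendsto lim h3 (Eventually.of_forall fun n => ?_)
  have hn : ((n : ℝ) + 1)⁻¹ ≠ 0 := by positivity
  have hn' : 0 < ((n : ℝ) + 1)⁻¹ := by positivity
  generalize ((n : ℝ) + 1)⁻¹ = σ at *
  have e2 : Ψ.comp (SM.ins σ) = (V (SM.ofCLM (dotL (σ⁻¹ • a)))).comp ((φ.comp (SM.ins σ)).comp
      (V (SM.ofCLM (dotL (-(σ⁻¹ • a)))))) :=
    SM.ext fun x => by
      simp only [SM.comp_apply, SM.ins_apply, hΨ, if_neg hn, V_dotL_apply, sub_neg_eq_add]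
      simp [Prod.ext_iff]
  rw [e2]
  have := RB_comp (RS_sub hn' (V_dotL hL (σ⁻¹ • a)))
    (RB_comp (h2 σ hn'.le) (RS_sub hn' (V_dotL hL (-(σ⁻¹ • a)))))
  rwa [show σ + (σ + σ) = 3 * σ by ring] at this

/-- Multiplication by the Gaussian. -/
def mulg (f : SM (Fin d → ℝ) ℝ) : SM (Fin d → ℝ) ℝ :=
  (SM.mk (fun z : ℝ × ℝ => z.1 * z.2) (by fun_prop)).comp (SM.pair (gs d) f)

lemma mulg_apply (f : SM (Fin d → ℝ) ℝ) (q : Fin d → ℝ) : mulg f q = gs d q * f q := rfl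

lemma grad_shift (f f' : SM (Fin d → ℝ) ℝ) (a : Fin d → ℝ) (h : ∀ q, f' q = f (q - a))
    (q : Fin d → ℝ) : grad f' q = grad f (q - a) := by
  funext i
  have e : (f' : (Fin d → ℝ) → ℝ) = fun q => f (q - a) := funext h
  rw [grad_apply, grad_apply, e, fderiv_comp_sub]

lemma V_shift (hL : ∃ L, LipschitzWith L (grad W)) {f f' : SM (Fin d → ℝ) ℝ} (a : Fin d → ℝ)
    (h : ∀ q, f' q = f (q - a)) (hf : V f ∈ RS (eucHam W)) : V f' ∈ RS (eucHam W) := by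
  have e : V f' = (Tr a).comp ((V f).comp (Tr (-a))) := SM.ext fun x => by
    simp only [SM.comp_apply, V_apply, Tr, SM.mk_apply]
    rw [grad_shift f f' a h]
    simp [sub_eq_add_neg]
  rw [e]
  exact RS_comp (Tr_mem hL a) (RS_comp hf (Tr_mem hL (-a)))

lemma V_gs_exp (hL : ∃ L, LipschitzWith L (grad W)) (c : ℝ) (l : (Fin d → ℝ) →L[ℝ] ℝ) :
    V (c • mulg (expSM l)) ∈ RS (eucHam W) := by
  obtain ⟨a, rfl⟩ := dotL_repr l
  have h : V (hc ((0 : Fin d → ℝ), c * Real.exp ((∑ i, a i ^ 2) / 2))) ∈ RS (eucHam W) := V_hc hL _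
  refine V_shift hL a (fun q => ?_) h
  have h0 : dotL (0 : Fin d → ℝ) (q - a) = 0 := by simp [dotL_apply]
  simp only [SM.smul_apply, mulg_apply, hc, SM.add_apply, SM.ofCLM_apply, h0, zero_add, smul_eq_mul,
    mul_assoc]
  congr 1
  show Real.exp _ * Real.exp _ = Real.exp _ * Real.exp _
  rw [← Real.exp_add, ← Real.exp_add]
  congr 1
  have : ∑ i, (q - a) i ^ 2 = ∑ i, q i ^ 2 - 2 * dotL a q + ∑ i, a i ^ 2 := by
    rw [dotL_apply, Finset.mul_sum, ← Finset.sum_sub_distrib, ← Finset.sum_add_distrib]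
    refine Finset.sum_congr rfl fun i _ => ?_
    simp only [Pi.sub_apply]; ring
  rw [this]; ring

lemma mulg_add (f h : SM (Fin d → ℝ) ℝ) : mulg (f + h) = mulg f + mulg h :=
  SM.ext fun q => by simp [mulg_apply, mul_add]

lemma mulg_smul (c : ℝ) (f : SM (Fin d → ℝ) ℝ) : mulg (c • f) = c • mulg f :=
  SM.ext fun q => by simp [mulg_apply, mul_left_comm]

lemma V_zero : V (0 : SM (Fin d → ℝ) ℝ) = SM.id := by
  refine SM.ext fun x => ?_
  have : grad (0 : SM (Fin d → ℝ) ℝ) = 0 := by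
    have := grad_smul 0 (0 : SM (Fin d → ℝ) ℝ); simpa using this
  simp [V_apply, this]

/-- Step 3: all vertical shears. -/
theorem V_mem (hL : ∃ L, LipschitzWith L (grad W)) (f : SM (Fin d → ℝ) ℝ) :
    V f ∈ RS (eucHam W) := by
  have h1 : ∀ m ∈ expSpan (Fin d → ℝ), ∀ c : ℝ, V (c • mulg m) ∈ RS (eucHam W) := by
    intro m hm
    induction hm using Submodule.span_induction with
    | mem m hm =>
      obtain ⟨l, rfl⟩ := hm
      exact fun c => V_gs_exp hL c l
    | zero =>
      intro c
      have : mulg (0 : SM (Fin d → ℝ) ℝ) = 0 := SM.ext fun q => by simp [mulg_apply]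
      rw [this, smul_zero, V_zero]; exact RS_id
    | add a b _ _ ha hb =>
      intro c
      rw [mulg_add, smul_add, V_add]; exact RS_comp (ha c) (hb c)
    | smul c' a _ ha =>
      intro c
      rw [mulg_smul, smul_smul]; exact ha _
  have h2 : ∀ f, V (mulg f) ∈ RS (eucHam W) := by
    intro f
    have hf := exp_dense f
    rw [mem_closure_iff_nhdsWithin_neBot] at hf
    have t : Tendsto (fun m => V (mulg m)) (𝓝[(expSpan (Fin d → ℝ) : Set _)] f) (𝓝 (V (mulg f))) :=
      tendsto_V (tendsto_comp tendsto_const_nhds (tendsto_pair tendsto_const_nhds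
        (tendsto_id.mono_left nhdsWithin_le_nhds)))
    refine RS_closed.mem_of_tendsto t ?_
    filter_upwards [self_mem_nhdsWithin] with m hm
    have := h1 m hm 1
    rwa [one_smul] at this
  have e : f = mulg (SM.mk (fun q => (gs d q)⁻¹ * f q) ((((gs d).smooth.inv
      fun q => (Real.exp_pos _).ne')).mul f.smooth)) := SM.ext fun q => by
    have : gs d q ≠ 0 := (Real.exp_pos _).ne'
    rw [mulg_apply, SM.mk_apply, ← mul_assoc, mul_inv_cancel₀ this, one_mul]
  rw [e]
  exact h2 _

lemma RB_iter {a : ℝ} {G : SM (Phase d) (Phase d)} (h : G ∈ RB (eucHam W) a) (n : ℕ) :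
    G.iter n ∈ RB (eucHam W) (n * a) := by
  induction n with
  | zero =>
    have : SM.id ∈ RB (eucHam W) 0 := subset_closure ⟨0, le_rfl, le_rfl, reachable_zero⟩
    rw [Nat.cast_zero, zero_mul]
    exact this
  | succ n ih =>
    have := RB_comp h ih
    rw [show ((n + 1 : ℕ) : ℝ) * a = a + n * a by push_cast; ring]
    exact this

/-- Horizontal linear shears. -/
def Us (s : ℝ) : SM (Phase d) (Phase d) := SM.mk (fun x => (x.1 + s • x.2, x.2)) (by fun_prop)

/-- Step 4: small positive horizontal shears. -/
lemma Us_pos (hL : ∃ L, LipschitzWith L (grad W)) {τ : ℝ} (hτ : 0 < τ) :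
    Us τ ∈ RB (eucHam W) (2 * τ) := by
  obtain ⟨φ, h0, h1, h2⟩ := ctl_flow hL 0
  have hc0 : hc (0 : (Fin d → ℝ) × ℝ) = 0 := by
    have := hc_smul (d := d) 0 0; simpa using this
  rw [hc0, add_zero] at h1
  let c : ℕ → ℝ := fun n => τ * ((n : ℝ) + 1)⁻¹
  have hc1 : Tendsto c atTop (𝓝 0) := by simpa using tendsto_inv_succ.const_mul τ
  have hcp : ∀ n, 0 < c n := fun n => by positivity
  let G : ℕ → SM (Phase d) (Phase d) := fun n => (φ.comp (SM.ins (c n))).comp (V ((-(c n)) • W))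
  let X : SM (Phase d) (Phase d) := SM.mk (fun x => (τ • x.2, 0)) (by fun_prop)
  have hs : Sol X (SM.id : SM (Phase d) (Phase d)) (Us τ) := by
    intro x
    refine ⟨fun t => (x.1 + t • (τ • x.2), x.2), by simp, fun t _ => ?_, by simp [Us]⟩
    have b : HasDerivAt (fun t : ℝ => x.1 + t • (τ • x.2)) (τ • x.2) t := by
      simpa using ((hasDerivAt_id t).smul_const (τ • x.2)).const_add x.1
    exact (b.prodMk (hasDerivAt_const t x.2)).hasDerivWithinAt
  have hV : Tendsto (fun n => V ((-(c n)) • W)) atTop (𝓝 SM.id) := by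
    have := tendsto_V (tendsto_smul hc1.neg (tendsto_const_nhds (x := W)))
    simpa [V_zero] using this
  let R : SM (Phase d) (Phase d) := SM.mk (fun x => (0, τ • grad W x.1)) (by
    have := (grad W).smooth
    fun_prop)
  have hG : Tendsto (fun n => ((n + 1 : ℕ) : ℝ) • (G n - SM.id)) atTop (𝓝 X) := by
    have t1 := flow_consistency (Yf W) φ h0 h1 hc1 (fun n => (hcp n).ne')
    have t2 := tendsto_add (tendsto_smul (tendsto_const_nhds (x := τ)) (tendsto_comp t1 hV))
      (tendsto_const_nhds (x := R))
    have e : τ • (Yf W).comp SM.id + R = X := SM.ext fun x => by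
      simp [Yf_apply, R, X]
    rw [e] at t2
    refine t2.congr fun n => SM.ext fun x => ?_
    have hn : ((n : ℝ) + 1) ≠ 0 := by positivity
    have e3 : τ * (c n)⁻¹ = n + 1 := by
      simp only [c]; field_simp
    have e4 : ((n : ℝ) + 1) * c n = τ := by
      simp only [c]; field_simp
    have e5 : R x = ((n : ℝ) + 1) • (V ((-(c n)) • W) x - x) := by
      rw [V_apply, grad_smul]
      simp only [SM.smul_apply, R, SM.mk_apply, Prod.ext_iff, Prod.smul_fst, Prod.smul_snd,
        Prod.fst_sub, Prod.snd_sub]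
      simp [smul_smul, e4]
    simp only [SM.add_apply, SM.smul_apply, SM.comp_apply, SM.sub_apply, SM.ins_apply, SM.id_apply,
      smul_smul, e3, e5, G]
    push_cast
    rw [← smul_add, sub_add_sub_cancel]
  have lim := chernoff hs succ_tendsto hG
  refine (RB_closed _).mem_of_tendsto lim (Eventually.of_forall fun n => ?_)
  have m1 : G n ∈ RB (eucHam W) (c n + c n) :=
    RB_comp (h2 _ (hcp n).le) (RS_sub (hcp n) (V_mem hL _))
  have m2 := RB_iter m1 (n + 1)
  have e : ((n + 1 : ℕ) : ℝ) * (c n + c n) = 2 * τ := by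
    have hn : ((n : ℝ) + 1) ≠ 0 := by positivity
    push_cast; simp only [c]; field_simp; ring
  rw [e] at m2
  exact m2

/-- Vertical linear shears. -/
def Lv (B : (Fin d → ℝ) →L[ℝ] (Fin d → ℝ)) : SM (Phase d) (Phase d) :=
  SM.mk (fun x => (x.1, x.2 + B x.1)) (by fun_prop)

lemma Lv_mem (hL : ∃ L, LipschitzWith L (grad W)) (B : (Fin d → ℝ) →L[ℝ] (Fin d → ℝ))
    (hB : ∀ x y, dotL (B x) y = dotL (B y) x) : Lv B ∈ RS (eucHam W) := by
  let f : SM (Fin d → ℝ) ℝ := SM.mk (fun q => -(1/2) * ∑ i, B q i * q i) (by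
    have h : ∀ i, ContDiff ℝ (⊤ : ℕ∞) (fun q => B q i) := fun i =>
      contDiff_pi.1 B.contDiff i
    fun_prop)
  have hf : ∀ q, HasFDerivAt f (-dotL (B q)) q := by
    intro q
    have h1 : ∀ i, HasFDerivAt (fun q => B q i * q i) ((B q i) • prj i + q i • (prj i).comp B) q := by
      intro i
      exact (((prj i).comp B).hasFDerivAt (x := q)).mul ((prj i).hasFDerivAt (x := q))
    have h2 := (HasFDerivAt.fun_sum (u := Finset.univ) fun i _ => h1 i).const_mul (-(1/2))
    refine h2.congr_fderiv ?_
    refine ContinuousLinearMap.ext fun v => ?_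
    have e : ∑ i, q i * B v i = dotL (B q) v := by
      rw [hB q v, dotL_apply]; exact Finset.sum_congr rfl fun i _ => mul_comm _ _
    simp [Finset.sum_add_distrib, e]
    rw [← dotL_apply]; ring
  have : Lv B = V f := SM.ext fun x => by
    rw [V_apply]
    have : grad f x.1 = - B x.1 := by
      funext i
      rw [grad_of_hasFDerivAt (hf x.1)]
      simp [dotL_single]
    rw [this]
    simp [Lv]
  rw [this]
  exact V_mem hL f

lemma Lv_smul_mem (hL : ∃ L, LipschitzWith L (grad W)) (c : ℝ) :
    Lv (c • ContinuousLinearMap.id ℝ (Fin d → ℝ)) ∈ RS (eucHam W) :=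
  Lv_mem hL _ fun x y => by
    simp only [dotL_apply]
    refine Finset.sum_congr rfl fun i _ => ?_
    simp; ring

/-- Step 5: all horizontal linear shears. -/
lemma Us_mem (hL : ∃ L, LipschitzWith L (grad W)) {s : ℝ} (hs : s ≠ 0) : Us s ∈ RS (eucHam W) := by
  refine RB_RS (a := 7) (fun τ hτ => ?_) (by norm_num)
  let c := (s - 2 * τ) / τ ^ 2
  let b := -(τ * c) / s
  let I := ContinuousLinearMap.id ℝ (Fin d → ℝ)
  have e : (Us s : SM (Phase d) (Phase d)) =
      (Lv (b • I)).comp ((Us τ).comp ((Lv (c • I)).comp ((Us τ).comp (Lv (b • I))))) := by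
    refine SM.ext fun x => Prod.ext (funext fun i => ?_) (funext fun i => ?_)
    · simp [Us, Lv, I, b, c]
      field_simp
      ring
    · simp [Us, Lv, I, b, c]
      field_simp
      ring
  rw [e]
  have := RB_comp (RS_sub hτ (Lv_smul_mem hL b)) (RB_comp (Us_pos hL hτ)
    (RB_comp (RS_sub hτ (Lv_smul_mem hL c)) (RB_comp (Us_pos hL hτ) (RS_sub hτ (Lv_smul_mem hL b)))))
  rwa [show τ + (2 * τ + (τ + (2 * τ + τ))) = 7 * τ by ring] at this

/-- Ridge maps. -/
def Rg (c : ℝ) (A B : Fin d → ℝ) : SM (Phase d) (Phase d) :=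
  SM.mk (fun x => x + (c * Real.exp (dotL A x.1 + dotL B x.2)) • (B, -A)) (by fun_prop)

lemma grad_exp (c : ℝ) (A q : Fin d → ℝ) :
    grad (c • expSM (dotL A)) q = (c * Real.exp (dotL A q)) • A := by
  rw [grad_smul]
  funext i
  have h : HasFDerivAt (expSM (dotL A)) (Real.exp (dotL A q) • dotL A) q :=
    ((dotL A).hasFDerivAt (x := q)).exp
  rw [SM.smul_apply, Pi.smul_apply, grad_of_hasFDerivAt h]
  simp [dotL_single, mul_assoc]

/-- Step 6: ridge maps. -/
theorem Rg_mem (hL : ∃ L, LipschitzWith L (grad W)) (c : ℝ) (A B : Fin d → ℝ) :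
    Rg c A B ∈ RS (eucHam W) := by
  by_cases hB : B = 0
  · subst hB
    have : Rg c A 0 = V (c • expSM (dotL A)) := SM.ext fun x => by
      rw [V_apply, grad_exp]
      have h0 : dotL (0 : Fin d → ℝ) x.2 = 0 := by simp [dotL_apply]
      simp [Rg, Prod.ext_iff, h0, sub_eq_add_neg]
    rw [this]
    exact V_mem hL _
  · have hB2 : dotL B B ≠ 0 := by
      rw [dotL_apply]
      intro h
      rw [Finset.sum_eq_zero_iff_of_nonneg (fun i _ => mul_self_nonneg _)] at h
      exact hB (funext fun i => mul_self_eq_zero.1 (h i (Finset.mem_univ i)))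
    set β := dotL B B with hβ
    let v := A - B
    let C : (Fin d → ℝ) →L[ℝ] (Fin d → ℝ) :=
      β⁻¹ • ((dotL B).smulRight v + (dotL v).smulRight B) - (dotL v B / β ^ 2) • (dotL B).smulRight B
    have hC : ∀ q, C q = β⁻¹ • (dotL B q • v + dotL v q • B) - (dotL v B / β ^ 2) • (dotL B q • B) :=
      fun q => rfl
    have hlin : ∀ (a b : ℝ) (x y z : Fin d → ℝ), dotL (a • x + b • y) z = a * dotL x z + b * dotL y z := by
      intro a b x y z
      simp [dotL_apply, Finset.mul_sum, add_mul, Finset.sum_add_distrib, mul_assoc]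
    have hdot : ∀ x y, dotL (C x) y = β⁻¹ * (dotL B x * dotL v y + dotL v x * dotL B y)
        - (dotL v B / β ^ 2) * (dotL B x * dotL B y) := by
      intro x y
      have : C x = (β⁻¹ * dotL B x) • v + (β⁻¹ * dotL v x - (dotL v B / β ^ 2) * dotL B x) • B := by
        rw [hC]; module
      rw [this, hlin]; ring
    have hsym : ∀ x y, dotL (C x) y = dotL (C y) x := by
      intro x y; rw [hdot, hdot]; ring
    have hCB : C B = v := by
      rw [hC, ← hβ]
      have : β⁻¹ • (β • v + dotL v B • B) - (dotL v B / β ^ 2) • (β • B) =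
        (β⁻¹ * β) • v + (β⁻¹ * dotL v B - (dotL v B / β ^ 2) * β) • B := by module
      rw [this, inv_mul_cancel₀ hB2]
      have : β⁻¹ * dotL v B - (dotL v B / β ^ 2) * β = 0 := by field_simp; ring
      rw [this]; simp
    have e : Rg c A B = (Lv (-C)).comp ((Us (-1)).comp ((V (c • expSM (dotL B))).comp
        ((Us 1).comp (Lv C)))) := SM.ext fun x => by
      simp only [SM.comp_apply, V_apply, grad_exp]
      have e1 : dotL B ((Us 1 : SM (Phase d) (Phase d)) (Lv C x)).1 = dotL A x.1 + dotL B x.2 := by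
        have : dotL B (C x.1) = dotL A x.1 - dotL B x.1 := by
          rw [dotL_comm, hsym, hCB]
          simp [v, dotL_apply, sub_mul, Finset.sum_sub_distrib]
        simp [Us, Lv, this]
        ring
      rw [e1]
      simp only [Rg, SM.mk_apply]
      generalize c * Real.exp (dotL A x.1 + dotL B x.2) = k
      have e2 : C (k • B) = k • (A - B) := by rw [map_smul, hCB]
      simp only [SM.mk_apply, Us, Lv]
      have e3 : x.1 + (1:ℝ) • (x.2 + C x.1) + (-1:ℝ) • (x.2 + C x.1 - k • B) = x.1 + k • B := by module
      rw [e3]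
      simp only [_root_.neg_apply, map_add, e2]
      refine Prod.ext rfl ?_
      show x.2 + k • -A = _
      module
    rw [e]
    have hneg : ∀ x y, dotL ((-C) x) y = dotL ((-C) y) x := by
      intro x y
      have := hlin (-1) 0
      simp only [neg_mul, one_mul, zero_mul, zero_smul, add_zero, neg_smul, one_smul] at this
      simp only [_root_.neg_apply]
      rw [this _ 0, this _ 0, hsym]
    exact RS_comp (Lv_mem hL _ hneg) (RS_comp (Us_mem hL (by norm_num))
      (RS_comp (V_mem hL _) (RS_comp (Us_mem hL one_ne_zero) (Lv_mem hL _ hsym))))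

end Dyn

end HamReach
end

end Part7

section Part8
open MeasureTheory Real

open Filter Topology

noncomputable section

namespace HamReach

section Final
variable {d : ℕ}

/-- The Hamiltonian structure map on the extended phase space. -/
def Jm (d : ℕ) : ((ℝ × Phase d) →L[ℝ] ℝ) →L[ℝ] (ℝ × Phase d) :=
  (0 : ((ℝ × Phase d) →L[ℝ] ℝ) →L[ℝ] ℝ).prod
    ((ContinuousLinearMap.pi fun i => ContinuousLinearMap.apply ℝ ℝ
        ((0, (0, Pi.single i 1)) : ℝ × Phase d)).prod
      (ContinuousLinearMap.pi fun i => -ContinuousLinearMap.apply ℝ ℝ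
        ((0, (Pi.single i 1, 0)) : ℝ × Phase d)))

lemma Jm_apply (L : (ℝ × Phase d) →L[ℝ] ℝ) : Jm d L =
    (0, (fun i => L (0, (0, Pi.single i 1)), fun i => -(L (0, (Pi.single i 1, 0))))) := rfl

/-- The Hamiltonian field on the extended phase space, without the time component. -/
def JH (H : SM (ℝ × Phase d) ℝ) : SM (ℝ × Phase d) (ℝ × Phase d) :=
  (SM.ofCLM (Jm d)).comp (SM.D H)

lemma JH_eq (H : SM (ℝ × Phase d) ℝ) (s : ℝ) (x : Phase d) :
    JH H (s, x) = (0, hamVF (fun y => H (s, y)) x) := by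
  have h : HasFDerivAt (fun y => H (s, y))
      ((fderiv ℝ H (s, x)).comp (ContinuousLinearMap.inr ℝ ℝ (Phase d))) x :=
    (H.differentiable (s, x)).hasFDerivAt.comp x (hasFDerivAt_prodMk_right s x)
  show Jm d (fderiv ℝ H (s, x)) = _
  rw [Jm_apply]
  simp only [hamVF, h.fderiv]
  rfl

lemma tendsto_JH {ι : Type*} {l : Filter ι} {H : ι → SM (ℝ × Phase d) ℝ} {H₀ : SM (ℝ × Phase d) ℝ}
    (h : Tendsto H l (𝓝 H₀)) : Tendsto (fun i => JH (H i)) l (𝓝 (JH H₀)) :=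
  tendsto_comp tendsto_const_nhds (tendsto_D h)

lemma JH_add (f h : SM (ℝ × Phase d) ℝ) : JH (f + h) = JH f + JH h := by
  refine SM.ext fun q => ?_
  have : fderiv ℝ (f + h : SM _ ℝ) q = fderiv ℝ f q + fderiv ℝ h q :=
    fderiv_add (f.differentiable _) (h.differentiable _)
  show Jm d (fderiv ℝ (f + h : SM _ ℝ) q) = Jm d (fderiv ℝ f q) + Jm d (fderiv ℝ h q)
  rw [this, map_add]

lemma JH_smul (c : ℝ) (f : SM (ℝ × Phase d) ℝ) : JH (c • f) = c • JH f := by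
  refine SM.ext fun q => ?_
  have : fderiv ℝ (c • f : SM _ ℝ) q = c • fderiv ℝ f q :=
    fderiv_const_smul (f.differentiable _) c
  show Jm d (fderiv ℝ (c • f : SM _ ℝ) q) = c • Jm d (fderiv ℝ f q)
  rw [this, map_smul]

/-- Fibred maps whose fibre maps are in `S`. -/
def Fib (S : Set (SM (Phase d) (Phase d))) (Γ : SM (ℝ × Phase d) (ℝ × Phase d)) : Prop :=
  ∃ h : ℝ, ∀ s, ∃ Φ ∈ S, ∀ x, Γ (s, x) = (s + h, Φ x)

/-- Fields which are limits of rescaled fibred maps. -/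
def CC (S : Set (SM (Phase d) (Phase d))) (X : SM (ℝ × Phase d) (ℝ × Phase d)) : Prop :=
  ∃ G : ℕ → SM (ℝ × Phase d) (ℝ × Phase d), (∀ n, Fib S (G n)) ∧
    Tendsto (fun n => ((n + 1 : ℕ) : ℝ) • (G n - SM.id)) atTop (𝓝 X)

lemma Fib_comp {S : Set (SM (Phase d) (Phase d))}
    (hcomp : ∀ Φ Ψ, Φ ∈ S → Ψ ∈ S → SM.comp Φ Ψ ∈ S)
    {Γ Γ' : SM (ℝ × Phase d) (ℝ × Phase d)} (h : Fib S Γ) (h' : Fib S Γ') :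
    Fib S (Γ.comp Γ') := by
  obtain ⟨a, ha⟩ := h
  obtain ⟨b, hb⟩ := h'
  refine ⟨b + a, fun s => ?_⟩
  obtain ⟨Φ, hΦ, h1⟩ := hb s
  obtain ⟨Ψ, hΨ, h2⟩ := ha (s + b)
  exact ⟨Ψ.comp Φ, hcomp _ _ hΨ hΦ, fun x => by
    rw [SM.comp_apply, h1, h2, SM.comp_apply, add_assoc]⟩

lemma Fib_id {S : Set (SM (Phase d) (Phase d))} (hid : SM.id ∈ S) :
    Fib S (SM.id : SM (ℝ × Phase d) (ℝ × Phase d)) :=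
  ⟨0, fun s => ⟨SM.id, hid, fun x => by simp⟩⟩

lemma Fib_iter {S : Set (SM (Phase d) (Phase d))} (hid : SM.id ∈ S)
    (hcomp : ∀ Φ Ψ, Φ ∈ S → Ψ ∈ S → SM.comp Φ Ψ ∈ S)
    {Γ : SM (ℝ × Phase d) (ℝ × Phase d)} (h : Fib S Γ) (n : ℕ) : Fib S (Γ.iter n) := by
  induction n with
  | zero => exact Fib_id hid
  | succ n ih => exact Fib_comp hcomp h ih

lemma CC_add {S : Set (SM (Phase d) (Phase d))}
    (hcomp : ∀ Φ Ψ, Φ ∈ S → Ψ ∈ S → SM.comp Φ Ψ ∈ S)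
    {X Y : SM (ℝ × Phase d) (ℝ × Phase d)} (hX : CC S X) (hY : CC S Y) : CC S (X + Y) := by
  obtain ⟨G, hG, hG2⟩ := hX
  obtain ⟨G', hG', hG2'⟩ := hY
  refine ⟨fun n => (G n).comp (G' n), fun n => Fib_comp hcomp (hG n) (hG' n), ?_⟩
  have hz : ∀ n : ℕ, ((n + 1 : ℕ) : ℝ) ≠ 0 := fun n => by positivity
  have hinv : Tendsto (fun n : ℕ => (((n + 1 : ℕ) : ℝ))⁻¹) atTop (𝓝 0) :=
    tendsto_inv_atTop_zero.comp (tendsto_natCast_atTop_atTop.comp succ_tendsto)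
  have h1 : Tendsto G' atTop (𝓝 SM.id) := by
    have := tendsto_add (tendsto_const_nhds (x := (SM.id : SM (ℝ × Phase d) (ℝ × Phase d))))
      (tendsto_smul hinv hG2')
    rw [zero_smul, add_zero] at this
    refine this.congr fun n => ?_
    rw [smul_smul, inv_mul_cancel₀ (hz n), one_smul]; abel
  have h2 := tendsto_add (tendsto_comp hG2 h1) hG2'
  have e : X.comp SM.id = X := SM.ext fun _ => rfl
  rw [e] at h2
  refine h2.congr fun n => SM.ext fun z => ?_
  simp only [SM.add_apply, SM.smul_apply, SM.sub_apply, SM.comp_apply, SM.id_apply]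
  rw [← smul_add]
  congr 1
  abel

lemma CC_exact {S : Set (SM (Phase d) (Phase d))} {X : SM (ℝ × Phase d) (ℝ × Phase d)}
    (h : ∀ r : ℝ, Fib S (SM.id + r • X)) : CC S X := by
  refine ⟨fun n => SM.id + (((n + 1 : ℕ) : ℝ))⁻¹ • X, fun n => h _, ?_⟩
  refine tendsto_const_nhds.congr fun n => ?_
  have hz : ((n + 1 : ℕ) : ℝ) ≠ 0 := by positivity
  rw [add_sub_cancel_left, smul_smul, mul_inv_cancel₀ hz, one_smul]

lemma CC_zero {S : Set (SM (Phase d) (Phase d))} (hid : SM.id ∈ S) :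
    CC S (0 : SM (ℝ × Phase d) (ℝ × Phase d)) :=
  CC_exact fun r => by rw [smul_zero, add_zero]; exact Fib_id hid

lemma CC_time {S : Set (SM (Phase d) (Phase d))} (hid : SM.id ∈ S) :
    CC S (SM.const (1, 0) : SM (ℝ × Phase d) (ℝ × Phase d)) :=
  CC_exact fun r => ⟨r, fun s => ⟨SM.id, hid, fun x => by
    simp only [SM.add_apply, SM.smul_apply, SM.id_apply, SM.const_apply]
    ext <;> simp⟩⟩

lemma JH_exp (L : (ℝ × Phase d) →L[ℝ] ℝ) (z : ℝ × Phase d) :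
    JH (expSM L) z = Real.exp (L z) • Jm d L := by
  have h : HasFDerivAt (expSM L) (Real.exp (L z) • L) z := L.hasFDerivAt.exp
  show Jm d (fderiv ℝ (expSM L) z) = _
  rw [h.fderiv, map_smul]

lemma CC_exp {W : SM (Fin d → ℝ) ℝ} (hL : ∃ L : NNReal, LipschitzWith L (grad W))
    (c : ℝ) (L : (ℝ × Phase d) →L[ℝ] ℝ) : CC (RS (eucHam W)) (JH (c • expSM L)) := by
  obtain ⟨A, hA⟩ := dotL_repr ((L.comp (ContinuousLinearMap.inr ℝ ℝ (Phase d))).comp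
    (ContinuousLinearMap.inl ℝ (Fin d → ℝ) (Fin d → ℝ)))
  obtain ⟨B, hB⟩ := dotL_repr ((L.comp (ContinuousLinearMap.inr ℝ ℝ (Phase d))).comp
    (ContinuousLinearMap.inr ℝ (Fin d → ℝ) (Fin d → ℝ)))
  have hA' : ∀ q, L (0, (q, 0)) = dotL A q := fun q => by rw [← hA]; rfl
  have hB' : ∀ q, L (0, (0, q)) = dotL B q := fun q => by rw [← hB]; rfl
  have hLz : ∀ s x, L (s, x) = L (s, 0) + (dotL A x.1 + dotL B x.2) := by
    intro s x
    rw [← hA', ← hB', ← map_add, ← map_add]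
    congr 1
    ext <;> simp
  have hJ : Jm d L = (0, (B, -A)) := by
    rw [Jm_apply]
    simp only [hA', hB', dotL_single]
    rfl
  refine CC_exact fun r => ⟨0, fun s => ⟨Rg (r * c * Real.exp (L (s, 0))) A B, Rg_mem hL _ A B,
    fun x => ?_⟩⟩
  rw [JH_smul]
  simp only [SM.add_apply, SM.smul_apply, SM.id_apply, JH_exp, hJ, hLz s x, Real.exp_add]
  refine Prod.ext (by simp) ?_
  show x + r • c • (Real.exp (L (s, 0)) * (Real.exp (dotL A x.1) * Real.exp (dotL B x.2))) • (B, -A)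
    = x + (r * c * Real.exp (L (s, 0)) * Real.exp (dotL A x.1 + dotL B x.2)) • (B, -A)
  rw [smul_smul, smul_smul, Real.exp_add]
  congr 2
  ring

lemma CC_span {W : SM (Fin d → ℝ) ℝ} (hL : ∃ L : NNReal, LipschitzWith L (grad W))
    {P : SM (ℝ × Phase d) ℝ} (hP : P ∈ expSpan (ℝ × Phase d)) (c : ℝ) :
    CC (RS (eucHam W)) (JH (c • P)) := by
  induction hP using Submodule.span_induction generalizing c with
  | mem x hx => obtain ⟨L, rfl⟩ := hx; exact CC_exp hL c L
  | zero =>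
    rw [JH_smul]
    have : JH (0 : SM (ℝ × Phase d) ℝ) = 0 := by
      have := JH_smul (0:ℝ) (0 : SM (ℝ × Phase d) ℝ)
      rwa [zero_smul, zero_smul] at this
    rw [this, smul_zero]
    exact CC_zero RS_id
  | add x y _ _ hx hy =>
    rw [smul_add, JH_add]
    exact CC_add (fun _ _ => RS_comp) (hx c) (hy c)
  | smul a x _ hx =>
    rw [smul_smul]
    exact hx _

theorem ham_mem_RS {W : SM (Fin d → ℝ) ℝ} (hL : ∃ L : NNReal, LipschitzWith L (grad W))
    (H : SM (ℝ × Phase d) ℝ) (φ : ℝ → Phase d → Phase d) (h0 : ∀ x, φ 0 x = x)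
    (hφ : ∀ x, ∀ t ∈ Set.Icc (0:ℝ) 1, HasDerivWithinAt (fun s => φ s x)
      (hamVF (fun y => H (t, y)) (φ t x)) (Set.Icc (0:ℝ) 1) t)
    (Ψ : SM (Phase d) (Phase d)) (hΨ : ∀ x, Ψ x = φ 1 x) : Ψ ∈ RS (eucHam W) := by
  classical
  let X : SM (ℝ × Phase d) ℝ → SM (ℝ × Phase d) (ℝ × Phase d) := fun P => SM.const (1, 0) + JH P
  have hX : ∀ P, P ∈ expSpan (ℝ × Phase d) → CC (RS (eucHam W)) (X P) := fun P hP => by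
    have := CC_span hL hP 1
    rw [one_smul] at this
    exact CC_add (fun _ _ => RS_comp) (CC_time RS_id) this
  have hex : ∀ P, ∃ G : ℕ → SM (ℝ × Phase d) (ℝ × Phase d), P ∈ expSpan (ℝ × Phase d) →
      (∀ n, Fib (RS (eucHam W)) (G n)) ∧
      Tendsto (fun n => ((n + 1 : ℕ) : ℝ) • (G n - SM.id)) atTop (𝓝 (X P)) := fun P => by
    by_cases hP : P ∈ expSpan (ℝ × Phase d)
    · obtain ⟨G, hG⟩ := hX P hP
      exact ⟨G, fun _ => hG⟩
    · exact ⟨fun _ => SM.id, fun h => absurd h hP⟩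
  choose G hG using hex
  let l₁ : Filter (SM (ℝ × Phase d) ℝ) := 𝓝[(expSpan (ℝ × Phase d) : Set _)] H
  have hne : l₁.NeBot := mem_closure_iff_nhdsWithin_neBot.1 (exp_dense H)
  let l : Filter (SM (ℝ × Phase d) ℝ × ℕ) := l₁.curry atTop
  have hlne : l.NeBot := by
    refine ⟨fun hb => ?_⟩
    have h1 : ∀ᶠ i in l, (fun _ : SM (ℝ × Phase d) ℝ × ℕ => False) i := by
      rw [hb]; exact mem_bot
    have h2 := eventually_curry_iff.1 h1
    obtain ⟨P, hP⟩ := h2.exists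
    exact hP.exists.elim fun _ h => h
  have hself : ∀ᶠ P in l₁, P ∈ expSpan (ℝ × Phase d) := self_mem_nhdsWithin
  have hX1 : Tendsto X l₁ (𝓝 (X H)) :=
    tendsto_add tendsto_const_nhds (tendsto_JH (tendsto_id.mono_left nhdsWithin_le_nhds))
  have hlim : Tendsto (fun i : SM (ℝ × Phase d) ℝ × ℕ =>
      ((i.2 + 1 : ℕ) : ℝ) • (G i.1 i.2 - SM.id)) l (𝓝 (X H)) := by
    rw [(nhds_basis_opens (X H)).tendsto_right_iff]
    rintro U ⟨hHU, hU⟩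
    refine eventually_curry_iff.2 ?_
    filter_upwards [hself, hX1 (hU.mem_nhds hHU)] with P hP hPU
    exact (hG P hP).2 (hU.mem_nhds hPU)
  have hn : Tendsto (fun i : SM (ℝ × Phase d) ℝ × ℕ => i.2 + 1) l atTop := by
    rw [tendsto_def]
    intro s hs
    refine eventually_curry_iff.2 (Eventually.of_forall fun P => ?_)
    exact succ_tendsto hs
  have hsol : Sol (X H) (SM.ins 0) (SM.pair (SM.const 1) Ψ) := by
    intro x
    refine ⟨fun t => (t, φ t x), ?_, ?_, ?_⟩
    · simp [h0]
    · intro t ht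
      have e : X H (t, φ t x) = (1, hamVF (fun y => H (t, y)) (φ t x)) := by
        show (1, 0) + JH H (t, φ t x) = _
        rw [JH_eq]; simp
      rw [e]
      exact (hasDerivWithinAt_id t _).prodMk (hφ x t ht)
    · simp [hΨ]
  have hch := chernoff hsol hn hlim
  have h2 := tendsto_comp (tendsto_const_nhds
    (x := SM.ofCLM (ContinuousLinearMap.snd ℝ ℝ (Phase d)))) hch
  have e : (SM.ofCLM (ContinuousLinearMap.snd ℝ ℝ (Phase d))).comp (SM.pair (SM.const 1) Ψ) = Ψ :=
    SM.ext fun _ => rfl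
  rw [e] at h2
  refine RS_closed.mem_of_tendsto h2 ?_
  refine eventually_curry_iff.2 ?_
  filter_upwards [hself] with P hP
  refine Eventually.of_forall fun n => ?_
  obtain ⟨a, ha⟩ := Fib_iter RS_id (fun _ _ => RS_comp) ((hG P hP).1 n) (n + 1)
  obtain ⟨Φ, hΦ, hh⟩ := ha 0
  have e2 : (SM.ofCLM (ContinuousLinearMap.snd ℝ ℝ (Phase d))).comp
      (((G P n).iter (n + 1)).comp (SM.ins 0)) = Φ := SM.ext fun x => by
    simp [hh x]
  rw [e2]
  exact hΦ

end Final

end HamReach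
end

end Part8

/-- **Theorem (small-time approximate controllability in `DHam(T*ℝ^d)`).**
For the Euclidean control system `H_u(q,p) = |p|²/2 + V_0(q) + Σ_{j=1}^d u_j q_j +
u_{d+1} e^{−|q|²/2}` with `V_0` smooth with globally Lipschitz gradient, every Hamiltonian
diffeomorphism of `T*ℝ^d` is small-time approximately reachable. -/
theorem euclidean_hamDiffeos_reachable
    (d : ℕ) (V0 : (Fin d → ℝ) → ℝ) (hV0 : ContDiff ℝ (⊤ : ℕ∞) V0)
    (hLip : ∃ L : NNReal, LipschitzWith L (fderiv ℝ V0)) :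
    ∀ Ψ : Phase d → Phase d, IsHamDiffeo Ψ →
      SmallTimeReachable (eucHam V0) Ψ := by
  rintro Ψ ⟨⟨hΨ, -⟩, H, φ, hH, h0, hφ, hΨφ⟩
  have hL := HamReach.lip_grad (W := HamReach.SM.mk V0 hV0) hLip
  exact HamReach.smallTime_of_RS (Ψ := HamReach.SM.mk Ψ hΨ)
    (HamReach.ham_mem_RS hL (HamReach.SM.mk (fun z : ℝ × Phase d => H z.1 z.2) hH) φ h0 hφ _
      (fun x => by rw [HamReach.SM.mk_apply, hΨφ]))
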